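/- Let $n\ge 0$, $m\ge 2n+1$ and $k=m-n-1$. Let $M$ be an $m$-dimensional triangulated manifold with possibly empty boundary, that is, a locally finite simplicial complex in which the link of every vertex is PL-homeomorphic to the boundary of the $m$-simplex or to the $(m-1)$-simplex, identified with its underlying space. Suppose that $M$ is (topologically) embedded into a real Hilbert space $H$ by a map which is linear on each simplex, and identify $M$ with its image. Let $\operatorname{Int}M$ be the manifold interior of $M$, let $K$ be a countable union of finite-dimensional affine planes in $H$ of dimension $\le k$, and set $X=M\setminus K$. Let $B^q$ be a $q$-dimensional PL-ball (a polyhedron PL-homeomorphic to the $q$-simplex) with $0\le q\le n$, and let $f:B^q\to\operatorname{Int}M$ be a PL-embedding. Then for every open cover $\mathcal U$ of $\operatorname{Int}M$ there is a PL-embedding $f':B^q\to\operatorname{Int}M$ such that $f'(B^q)\subset X$ and, for every $b\in B^q$, some element of $\mathcal U$ contains both $f(b)$ and $f'(b)$. -/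

import Mathlib

open Set Topology

namespace NobelingPL

section PL

variable {E F : Type*} [AddCommGroup E] [Module ℝ E] [AddCommGroup F] [Module ℝ F]

/-- A map `f : A → C` from a compact polyhedron `A` (the underlying set of a finite simplicial
complex) is a PL-map if `A` has a finite triangulation such that `f` is affine on each simplex.
Such a map is automatically continuous. -/
def IsPLMap {A : Set E} {C : Set F} (f : A → C) : Prop :=
  ∃ T : Geometry.SimplicialComplex ℝ E, T.faces.Finite ∧ T.space = A ∧
    ∀ s ∈ T.faces, ∃ g : E →ᵃ[ℝ] F,
      ∀ x : A, (x : E) ∈ convexHull ℝ (s : Set E) → (f x : F) = g x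

/-- A PL-embedding of a compact polyhedron: an injective PL-map. Since `A` is compact,
`f` is then a homeomorphism onto its image. -/
def IsPLEmbedding {A : Set E} {C : Set F} (f : A → C) : Prop :=
  IsPLMap f ∧ Function.Injective f

/-- Two compact polyhedra are PL-homeomorphic. The inverse of a bijective PL-map is PL: the
images of the simplexes of a triangulation on which it is affine triangulate the target. -/
def PLHomeomorphic (A : Set E) (C : Set F) : Prop :=
  ∃ f : A → C, IsPLMap f ∧ Function.Bijective f

/-- The boundary of the standard simplex with vertices indexed by `Fin d`. -/
def stdSimplexBoundary (d : ℕ) : Set (Fin d → ℝ) :=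
  {x ∈ stdSimplex ℝ (Fin d) | ∃ i, x i = 0}

/-- A `q`-dimensional PL-ball: a polyhedron PL-homeomorphic to the `q`-simplex. -/
def IsPLBall (q : ℕ) (B : Set E) : Prop :=
  PLHomeomorphic B (stdSimplex ℝ (Fin (q + 1)))

/-- The underlying set of the link of the vertex `v` in the simplicial complex `M`. -/
def linkSpace (M : Geometry.SimplicialComplex ℝ E) (v : E) : Set E :=
  ⋃ t ∈ {t : Finset E | t ∈ M.faces ∧ v ∉ t ∧ ∃ u ∈ M.faces, v ∈ u ∧ t ⊆ u},
    convexHull ℝ (t : Set E)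

end PL

section Manifold

variable {H : Type*} [NormedAddCommGroup H] [InnerProductSpace ℝ H]

/-- Each point of the underlying space of `M` has a neighbourhood meeting only finitely many
simplexes. For a complex whose simplexes are linear in `H` this says that the abstract complex
is locally finite and that its underlying space, with the topology of a locally finite complex,
is topologically embedded in `H`. -/
def IsLocallyFinite (M : Geometry.SimplicialComplex ℝ H) : Prop :=
  ∀ x ∈ M.space, ∃ U : Set H, IsOpen U ∧ x ∈ U ∧
    {s ∈ M.faces | (convexHull ℝ (s : Set H) ∩ U).Nonempty}.Finite

/-- `M` is a triangulated (combinatorial) manifold of dimension `m` with possibly empty boundary: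
a locally finite complex in which the link of each vertex is PL-homeomorphic to the boundary of
the `m`-simplex (an `(m-1)`-sphere) or to the `(m-1)`-simplex (an `(m-1)`-ball). The latter is the
standard simplex with `m` vertices. -/
def IsCombinatorialManifold (M : Geometry.SimplicialComplex ℝ H) (m : ℕ) : Prop :=
  IsLocallyFinite M ∧ ∀ v ∈ M.vertices,
    PLHomeomorphic (linkSpace M v) (stdSimplexBoundary (m + 1)) ∨
      PLHomeomorphic (linkSpace M v) (stdSimplex ℝ (Fin m))

/-- The manifold interior `Int M`: the points `x` that have a neighbourhood `N` in `M` and a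
PL-homeomorphism of `N` onto the `m`-simplex sending `x` to an interior point of the simplex. -/
def manifoldInterior (M : Geometry.SimplicialComplex ℝ H) (m : ℕ) : Set H :=
  {x | ∃ N : Set H, N ⊆ M.space ∧ N ∈ 𝓝[M.space] x ∧ ∃ hx : x ∈ N,
    ∃ φ : N → stdSimplex ℝ (Fin (m + 1)), IsPLMap φ ∧ Function.Bijective φ ∧
      ∀ i, 0 < (φ ⟨x, hx⟩).val i}

end Manifold

/-- `𝒰` is an open cover of the space `Y`. -/
def IsOpenCover {Y : Type*} [TopologicalSpace Y] (𝒰 : Set (Set Y)) : Prop :=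
  (∀ U ∈ 𝒰, IsOpen U) ∧ ⋃₀ 𝒰 = univ

/-- Two maps are `𝒰`-close: for every point some element of `𝒰` contains both of its images. -/
def UClose {A Y : Type*} (𝒰 : Set (Set Y)) (f g : A → Y) : Prop :=
  ∀ a : A, ∃ U ∈ 𝒰, f a ∈ U ∧ g a ∈ U

end NobelingPL

namespace NobelingPL

section Weights

variable {E : Type*}

/-- The sum of the coefficients of a finitely supported weight function. -/
noncomputable def totalWeight : (E →₀ ℝ) →ₗ[ℝ] ℝ := Finsupp.linearCombination ℝ fun _ => (1 : ℝ)

@[simp] lemma totalWeight_single (x : E) (r : ℝ) : totalWeight (Finsupp.single x r) = r := by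
  simp [totalWeight]

lemma totalWeight_eq_sum {s : Finset E} {w : E →₀ ℝ} (h : w.support ⊆ s) :
    totalWeight w = ∑ y ∈ s, w y := by
  rw [totalWeight, Finsupp.linearCombination_apply, Finsupp.sum_of_support_subset _ h _ (by simp)]
  simp

lemma support_nonempty_of_totalWeight {w : E →₀ ℝ} (h : totalWeight w = 1) :
    w.support.Nonempty := by
  rw [Finsupp.support_nonempty_iff]
  rintro rfl
  simp at h

variable [AddCommGroup E] [Module ℝ E]

/-- The linear combination of points with the given weights. -/
noncomputable def weightedSum : (E →₀ ℝ) →ₗ[ℝ] E := Finsupp.linearCombination ℝ (id : E → E)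

@[simp] lemma weightedSum_single (x : E) (r : ℝ) : weightedSum (Finsupp.single x r) = r • x := by
  simp [weightedSum]

lemma weightedSum_eq_sum {s : Finset E} {w : E →₀ ℝ} (h : w.support ⊆ s) :
    weightedSum w = ∑ y ∈ s, w y • y := by
  rw [weightedSum, Finsupp.linearCombination_apply, Finsupp.sum_of_support_subset _ h _ (by simp)]
  simp

lemma mem_convexHull_iff_weights {s : Finset E} {x : E} :
    x ∈ convexHull ℝ (s : Set E) ↔
      ∃ w : E →₀ ℝ, 0 ≤ w ∧ w.support ⊆ s ∧ totalWeight w = 1 ∧ weightedSum w = x := by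
  classical
  rw [Finset.mem_convexHull']
  constructor
  · rintro ⟨w, h0, h1, hx⟩
    have hsupp : (Finsupp.indicator s fun y _ => w y).support ⊆ s :=
      Finsupp.support_indicator_subset _ _
    refine ⟨Finsupp.indicator s fun y _ => w y, fun y => ?_, hsupp, ?_, ?_⟩
    · by_cases hy : y ∈ s
      · simpa [Finsupp.indicator_apply, hy] using h0 y hy
      · simp [Finsupp.indicator_apply, hy]
    · rw [totalWeight_eq_sum hsupp, ← h1]
      exact Finset.sum_congr rfl fun y hy => by simp [Finsupp.indicator_apply, hy]
    · rw [weightedSum_eq_sum hsupp, ← hx]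
      exact Finset.sum_congr rfl fun y hy => by simp [Finsupp.indicator_apply, hy]
  · rintro ⟨w, h0, hs, h1, hx⟩
    exact ⟨w, fun y _ => h0 y, by rw [← totalWeight_eq_sum hs, h1],
      by rw [← weightedSum_eq_sum hs, hx]⟩

lemma affineIndependent_iff_weights {s : Finset E} :
    AffineIndependent ℝ ((↑) : s → E) ↔
      ∀ u : E →₀ ℝ, u.support ⊆ s → totalWeight u = 0 → weightedSum u = 0 → u = 0 := by
  classical
  rw [affineIndependent_iff]
  constructor
  · intro h u hs h0 h1
    have key := h Finset.univ (fun y : s => u y)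
      (by rw [totalWeight_eq_sum hs] at h0; rw [← h0]; exact Finset.sum_coe_sort s fun y => u y)
      (by rw [weightedSum_eq_sum hs] at h1; rw [← h1]
          exact Finset.sum_coe_sort s fun y => u y • y)
    ext y
    by_cases hy : y ∈ s
    · exact key ⟨y, hy⟩ (Finset.mem_univ _)
    · exact Finsupp.notMem_support_iff.1 fun h => hy (hs h)
  · intro h t w h0 h1 e he
    let u : E →₀ ℝ := ∑ i ∈ t, Finsupp.single (i : E) (w i)
    have hu : u = 0 := by
      refine h u (fun y hy => ?_) ?_ ?_
      · by_contra hys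
        apply Finsupp.mem_support_iff.1 hy
        simp only [u, Finsupp.coe_finsetSum, Finset.sum_apply]
        refine Finset.sum_eq_zero fun i _ => Finsupp.single_eq_of_ne ?_
        rintro rfl
        exact hys i.2
      · simpa [u] using h0
      · simpa [u] using h1
    have := DFunLike.congr_fun hu (e : E)
    simp only [u, Finsupp.coe_finsetSum, Finset.sum_apply, Finsupp.coe_zero, Pi.zero_apply] at this
    rw [Finset.sum_eq_single e] at this
    · simpa using this
    · intro i _ hi
      exact Finsupp.single_eq_of_ne fun h => hi (Subtype.ext h.symm)
    · exact fun h => (h he).elim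

lemma eq_of_weights {s : Finset E} (hs : AffineIndependent ℝ ((↑) : s → E)) {w w' : E →₀ ℝ}
    (hw : w.support ⊆ s) (hw' : w'.support ⊆ s) (h1 : totalWeight w = totalWeight w')
    (h2 : weightedSum w = weightedSum w') : w = w' := by
  classical
  refine sub_eq_zero.1 (affineIndependent_iff_weights.1 hs (w - w') ?_ ?_ ?_)
  · exact Finsupp.support_sub.trans (Finset.union_subset hw hw')
  · rw [map_sub, h1, sub_self]
  · rw [map_sub, h2, sub_self]

lemma face_weights_unique (T : Geometry.SimplicialComplex ℝ E) {w w' : E →₀ ℝ}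
    (h0 : 0 ≤ w) (h0' : 0 ≤ w') (hs : w.support ∈ T.faces) (hs' : w'.support ∈ T.faces)
    (h1 : totalWeight w = 1) (h1' : totalWeight w' = 1) (h : weightedSum w = weightedSum w') :
    w = w' := by
  classical
  have hx : weightedSum w ∈ convexHull ℝ (w.support : Set E) :=
    mem_convexHull_iff_weights.2 ⟨w, h0, subset_rfl, h1, rfl⟩
  have hx' : weightedSum w ∈ convexHull ℝ (w'.support : Set E) :=
    mem_convexHull_iff_weights.2 ⟨w', h0', subset_rfl, h1', h.symm⟩
  have := T.inter_subset_convexHull hs hs' ⟨hx, hx'⟩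
  rw [← Finset.coe_inter, mem_convexHull_iff_weights] at this
  obtain ⟨v, -, hv, hv1, hvx⟩ := this
  rw [← eq_of_weights (T.indep hs) (hv.trans Finset.inter_subset_left) subset_rfl
    (hv1.trans h1.symm) hvx]
  exact eq_of_weights (T.indep hs') (hv.trans Finset.inter_subset_right) subset_rfl
    (hv1.trans h1'.symm) (hvx.trans h)

/-- A family of finite sets in which points have at most one expression as a convex combination
over a member of the family is a simplicial complex. -/
def complexOfUniqueWeights (faces : Set (Finset E)) (hlower : IsRelLowerSet faces Finset.Nonempty)
    (huniq : ∀ w w' : E →₀ ℝ, 0 ≤ w → 0 ≤ w' → w.support ∈ faces → w'.support ∈ faces →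
      totalWeight w = 1 → totalWeight w' = 1 → weightedSum w = weightedSum w' → w = w') :
    Geometry.SimplicialComplex ℝ E where
  faces := faces
  isRelLowerSet_faces := hlower
  indep := by
    classical
    intro s hs
    refine affineIndependent_iff_weights.2 fun u hus h0 h1 => ?_
    have hsub : u = u⁺ - u⁻ := (posPart_sub_negPart u).symm
    have htot : totalWeight u⁺ = totalWeight u⁻ := by
      rw [← sub_eq_zero, ← map_sub, ← hsub, h0]
    have hsum : weightedSum u⁺ = weightedSum u⁻ := by
      rw [← sub_eq_zero, ← map_sub, ← hsub, h1]
    have hsp : u⁺.support ⊆ s := by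
      intro y hy
      by_contra hys
      have : u y = 0 := Finsupp.notMem_support_iff.1 fun h => hys (hus h)
      apply Finsupp.mem_support_iff.1 hy
      simp [posPart, this]
    have hsn : u⁻.support ⊆ s := by
      intro y hy
      by_contra hys
      have : u y = 0 := Finsupp.notMem_support_iff.1 fun h => hys (hus h)
      apply Finsupp.mem_support_iff.1 hy
      simp [negPart, this]
    by_cases ht : totalWeight u⁺ = 0
    · have zero_of : ∀ v : E →₀ ℝ, 0 ≤ v → totalWeight v = 0 → v = 0 := by
        intro v hv hv0
        rw [totalWeight_eq_sum subset_rfl, Finset.sum_eq_zero_iff_of_nonneg fun y _ => hv y] at hv0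
        ext y
        by_cases hy : y ∈ v.support
        · exact hv0 y hy
        · exact Finsupp.notMem_support_iff.1 hy
      rw [hsub, zero_of _ (posPart_nonneg u) ht, zero_of _ (negPart_nonneg u) (htot ▸ ht), sub_zero]
    · have hpos : 0 < totalWeight u⁺ := by
        refine lt_of_le_of_ne ?_ (Ne.symm ht)
        rw [totalWeight_eq_sum subset_rfl]
        exact Finset.sum_nonneg fun y _ => posPart_nonneg u y
      set c := (totalWeight u⁺)⁻¹ with hc
      have hc0 : 0 < c := inv_pos.2 hpos
      have h1p : totalWeight (c • u⁺) = 1 := by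
        rw [map_smul, smul_eq_mul, hc, inv_mul_cancel₀ ht]
      have h1n : totalWeight (c • u⁻) = 1 := by
        rw [map_smul, ← htot, smul_eq_mul, hc, inv_mul_cancel₀ ht]
      have := huniq (c • u⁺) (c • u⁻) (smul_nonneg hc0.le (posPart_nonneg u))
        (smul_nonneg hc0.le (negPart_nonneg u))
        ((hlower hs).2 (Finsupp.support_smul.trans hsp) (support_nonempty_of_totalWeight h1p))
        ((hlower hs).2 (Finsupp.support_smul.trans hsn) (support_nonempty_of_totalWeight h1n))
        h1p h1n (by rw [map_smul, map_smul, hsum])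
      rw [hsub, smul_right_injective _ hc0.ne' this, sub_self]
  inter_subset_convexHull := by
    classical
    rintro s t hs ht x ⟨hxs, hxt⟩
    obtain ⟨w, h0, hws, h1, hx⟩ := mem_convexHull_iff_weights.1 hxs
    obtain ⟨w', h0', hwt, h1', hx'⟩ := mem_convexHull_iff_weights.1 hxt
    obtain rfl := huniq w w' h0 h0' ((hlower hs).2 hws (support_nonempty_of_totalWeight h1))
      ((hlower ht).2 hwt (support_nonempty_of_totalWeight h1')) h1 h1' (hx.trans hx'.symm)
    rw [← Finset.coe_inter]
    exact mem_convexHull_iff_weights.2 ⟨w, h0, Finset.subset_inter hws hwt, h1, hx⟩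

end Weights

section Subdivision

variable {E : Type*} [AddCommGroup E] [Module ℝ E]

open Classical in
/-- The faces of the stellar subdivision of `T` at a point `p` of the edge with endpoints
`a` and `b`. -/
def edgeSubdivisionFaces (T : Geometry.SimplicialComplex ℝ E) (a b p : E) : Set (Finset E) :=
  {s | s.Nonempty ∧ ¬(a ∈ s ∧ b ∈ s) ∧
    (s ∈ T.faces ∨ p ∈ s ∧ s.erase p ∪ {a, b} ∈ T.faces)}

lemma isRelLowerSet_edgeSubdivisionFaces (T : Geometry.SimplicialComplex ℝ E) (a b p : E) :
    IsRelLowerSet (edgeSubdivisionFaces T a b p) Finset.Nonempty := by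
  classical
  rintro s ⟨hne, hab, h⟩
  refine ⟨hne, fun t hts htne => ⟨htne, fun h => hab ⟨hts h.1, hts h.2⟩, ?_⟩⟩
  rcases h with h | ⟨hp, h⟩
  · exact Or.inl (T.down_closed h hts htne)
  · by_cases hpt : p ∈ t
    · refine Or.inr ⟨hpt, T.down_closed h ?_ ⟨a, by simp⟩⟩
      exact Finset.union_subset_union (Finset.erase_subset_erase p hts) subset_rfl
    · refine Or.inl (T.down_closed h (fun y hy => ?_) htne)
      refine Finset.mem_union_left _ (Finset.mem_erase.2 ⟨?_, hts hy⟩)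
      rintro rfl
      exact hpt hy

variable {T : Geometry.SimplicialComplex ℝ E} {a b p : E} {τ : ℝ}

lemma notMem_face_of_edge_point (hab : a ≠ b) {e : Finset E} (he : e ∈ T.faces) (ha : a ∈ e)
    (hb : b ∈ e) (h0 : 0 < τ) (h1 : τ < 1) (hp : p = (1 - τ) • a + τ • b) {s : Finset E}
    (hs : s ∈ T.faces) : p ∉ s := by
  classical
  intro hps
  have hv : p ∈ T.vertices := T.down_closed hs (Finset.singleton_subset_iff.2 hps) (by simp)
  have hE : ({a, b} : Finset E) ∈ T.faces := T.down_closed he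
    (Finset.insert_subset ha (Finset.singleton_subset_iff.2 hb)) (by simp)
  have hpe : p ∈ convexHull ℝ (({a, b} : Finset E) : Set E) := by
    rw [Finset.coe_pair, convexHull_pair]
    exact ⟨1 - τ, τ, by linarith, h0.le, by ring, hp.symm⟩
  have := (T.vertex_mem_convexHull_iff hv hE).1 hpe
  simp only [Finset.mem_insert, Finset.mem_singleton] at this
  rcases this with h | h
  · have : τ • (b - a) = 0 := by
      have h2 : (1 - τ) • a + τ • b = a := hp ▸ h
      calc τ • (b - a) = ((1 - τ) • a + τ • b) - a := by module
        _ = 0 := by rw [h2, sub_self]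
    rcases smul_eq_zero.1 this with h | h
    · exact h0.ne' h
    · exact hab (sub_eq_zero.1 h).symm
  · have : (1 - τ) • (a - b) = 0 := by
      have h2 : (1 - τ) • a + τ • b = b := hp ▸ h
      calc (1 - τ) • (a - b) = ((1 - τ) • a + τ • b) - b := by module
        _ = 0 := by rw [h2, sub_self]
    rcases smul_eq_zero.1 this with h | h
    · linarith
    · exact hab (sub_eq_zero.1 h)

/-- Replace the weight of `p` by weights of the endpoints of the edge containing it. -/
lemma exists_face_weights_of_edgeSubdivision
    (hnp : ∀ s ∈ T.faces, p ∉ s) (h0 : 0 < τ) (h1 : τ < 1) (hp : p = (1 - τ) • a + τ • b)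
    {w : E →₀ ℝ} (hw0 : 0 ≤ w) (hw : w.support ∈ edgeSubdivisionFaces T a b p)
    (hw1 : totalWeight w = 1) (v : E →₀ ℝ) (hv : v = w + w p •
      ((1 - τ) • Finsupp.single a 1 + τ • Finsupp.single b 1 - Finsupp.single p 1)) :
    0 ≤ v ∧ v.support ∈ T.faces ∧ totalWeight v = 1 ∧ weightedSum v = weightedSum w := by
  classical
  obtain ⟨hne, hab, h⟩ := hw
  have hv1 : totalWeight v = 1 := by
    simp [hv, hw1]
  have hvx : weightedSum v = weightedSum w := by
    have : (1 - τ) • a + τ • b - p = 0 := by rw [hp, sub_self]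
    simp only [hv, map_add, map_sub, map_smul, weightedSum_single, one_smul, this, smul_zero,
      add_zero]
  refine ⟨?_, ?_, hv1, hvx⟩
  · intro y
    have hy := hw0 y
    have hpp := hw0 p
    simp only [Finsupp.coe_zero, Pi.zero_apply] at hy hpp
    simp only [hv, Finsupp.coe_zero, Pi.zero_apply, Finsupp.coe_add, Finsupp.coe_smul,
      Finsupp.coe_sub, Pi.add_apply, Pi.smul_apply, Pi.sub_apply, Finsupp.single_apply, smul_eq_mul]
    have ha : 0 ≤ (1 - τ) * (if a = y then (1 : ℝ) else 0) := by
      split_ifs <;> simp [h1.le]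
    have hb : 0 ≤ τ * (if b = y then (1 : ℝ) else 0) := by
      split_ifs <;> simp [h0.le]
    by_cases hpy : p = y
    · rw [if_pos hpy, ← hpy]
      rw [← hpy] at ha hb
      nlinarith [mul_nonneg hpp (add_nonneg ha hb)]
    · rw [if_neg hpy]
      nlinarith [mul_nonneg hpp (add_nonneg ha hb)]
  · rcases h with h | ⟨hps, h⟩
    · have : w p = 0 := Finsupp.notMem_support_iff.1 (hnp _ h)
      rw [this, zero_smul, add_zero] at hv
      rwa [hv]
    · refine T.down_closed h (fun y hy => ?_) (support_nonempty_of_totalWeight hv1)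
      by_contra hys
      simp only [Finset.mem_union, Finset.mem_erase, Finset.mem_insert, Finset.mem_singleton,
        not_or, not_and_or, not_not] at hys
      obtain ⟨hy1, hya, hyb⟩ := hys
      apply Finsupp.mem_support_iff.1 hy
      have ea : (if a = y then (1 : ℝ) else 0) = 0 := if_neg (Ne.symm hya)
      have eb : (if b = y then (1 : ℝ) else 0) = 0 := if_neg (Ne.symm hyb)
      simp only [hv, Finsupp.coe_add, Finsupp.coe_smul,
        Finsupp.coe_sub, Pi.add_apply, Pi.smul_apply, Pi.sub_apply, Finsupp.single_apply,
        smul_eq_mul, ea, eb]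
      rcases hy1 with rfl | hy1
      · simp
      · have hwy : w y = 0 := Finsupp.notMem_support_iff.1 hy1
        have : p ≠ y := by rintro rfl; exact hy1 hps
        simp [hwy, this]

lemma edgeSubdivision_weights_unique (hab : a ≠ b) (hpa : p ≠ a) (hpb : p ≠ b)
    (hnp : ∀ s ∈ T.faces, p ∉ s) (h0 : 0 < τ) (h1 : τ < 1) (hp : p = (1 - τ) • a + τ • b)
    (w w' : E →₀ ℝ) (hw0 : 0 ≤ w) (hw0' : 0 ≤ w')
    (hw : w.support ∈ edgeSubdivisionFaces T a b p)
    (hw' : w'.support ∈ edgeSubdivisionFaces T a b p)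
    (hw1 : totalWeight w = 1) (hw1' : totalWeight w' = 1) (h : weightedSum w = weightedSum w') :
    w = w' := by
  classical
  obtain ⟨v0, vs, v1, vx⟩ :=
    exists_face_weights_of_edgeSubdivision hnp h0 h1 hp hw0 hw hw1 _ rfl
  obtain ⟨v0', vs', v1', vx'⟩ :=
    exists_face_weights_of_edgeSubdivision hnp h0 h1 hp hw0' hw' hw1' _ rfl
  have heq := face_weights_unique T v0 v0' vs vs' v1 v1' (by rw [vx, vx', h])
  have hA := DFunLike.congr_fun heq a
  have hB := DFunLike.congr_fun heq b
  simp only [Finsupp.coe_add, Finsupp.coe_smul, Finsupp.coe_sub, Pi.add_apply, Pi.smul_apply,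
    Pi.sub_apply, Finsupp.single_apply, smul_eq_mul, if_true, hab, hab.symm, if_false, hpa, hpb]
    at hA hB
  have aux : ∀ u : E →₀ ℝ, u.support ∈ edgeSubdivisionFaces T a b p → u a = 0 ∨ u b = 0 := by
    rintro u ⟨-, hu, -⟩
    simpa only [Finsupp.mem_support_iff, not_and_or, not_not] using hu
  have key : w p = w' p := by
    have wa := hw0 a
    have wb := hw0 b
    have wa' := hw0' a
    have wb' := hw0' b
    simp only [Finsupp.coe_zero, Pi.zero_apply] at wa wb wa' wb'
    by_contra hne
    rcases lt_or_gt_of_ne hne with hlt | hlt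
    · rcases aux w hw with h | h
      · nlinarith [mul_pos (sub_pos.2 h1) (sub_pos.2 hlt)]
      · nlinarith [mul_pos h0 (sub_pos.2 hlt)]
    · rcases aux w' hw' with h | h
      · nlinarith [mul_pos (sub_pos.2 h1) (sub_pos.2 hlt)]
      · nlinarith [mul_pos h0 (sub_pos.2 hlt)]
  rw [key] at heq
  exact add_right_cancel heq

lemma exists_edgeSubdivision_face_mem (hab : a ≠ b)
    (hnp : ∀ s ∈ T.faces, p ∉ s) (h0 : 0 < τ) (h1 : τ < 1) (hp : p = (1 - τ) • a + τ • b)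
    {x : E} (hx : x ∈ T.space) :
    ∃ s ∈ edgeSubdivisionFaces T a b p, x ∈ convexHull ℝ (s : Set E) := by
  classical
  obtain ⟨s, hs, hxs⟩ := T.mem_space_iff.1 hx
  obtain ⟨w, hw0, hws, hw1, hwx⟩ := mem_convexHull_iff_weights.1 hxs
  have hw : w.support ∈ T.faces := T.down_closed hs hws (support_nonempty_of_totalWeight hw1)
  by_cases hboth : w a = 0 ∨ w b = 0
  · refine ⟨w.support, ⟨support_nonempty_of_totalWeight hw1, ?_, Or.inl hw⟩,
      mem_convexHull_iff_weights.2 ⟨w, hw0, subset_rfl, hw1, hwx⟩⟩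
    simpa only [Finsupp.mem_support_iff, not_and_or, not_not] using hboth
  · push Not at hboth
    have wa : 0 < w a := lt_of_le_of_ne (hw0 a) hboth.1.symm
    have wb : 0 < w b := lt_of_le_of_ne (hw0 b) hboth.2.symm
    have haw : a ∈ w.support := Finsupp.mem_support_iff.2 hboth.1
    have hbw : b ∈ w.support := Finsupp.mem_support_iff.2 hboth.2
    have hpa : p ≠ a := by rintro rfl; exact hnp _ hw haw
    have hpb : p ≠ b := by rintro rfl; exact hnp _ hw hbw
    have wp : w p = 0 := Finsupp.notMem_support_iff.1 (hnp _ hw)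
    have h1' : 0 < 1 - τ := sub_pos.2 h1
    set γ := min (w a / (1 - τ)) (w b / τ) with hγ
    have hγ0 : 0 < γ := lt_min (div_pos wa h1') (div_pos wb h0)
    have hγa : γ * (1 - τ) ≤ w a := (le_div_iff₀ h1').1 (min_le_left _ _)
    have hγb : γ * τ ≤ w b := (le_div_iff₀ h0).1 (min_le_right _ _)
    set v : E →₀ ℝ := w + γ •
      (Finsupp.single p 1 - (1 - τ) • Finsupp.single a 1 - τ • Finsupp.single b 1) with hv
    have hva : v a = w a - γ * (1 - τ) := by
      simp [hv, hpa, hab.symm]; ring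
    have hvb : v b = w b - γ * τ := by
      simp [hv, hpb, hab]; ring
    have hvp : v p = γ := by
      simp [hv, hpb.symm, hpa.symm, wp]
    have hvy : ∀ y, y ≠ a → y ≠ b → y ≠ p → v y = w y := by
      intro y ha hb hp
      simp [hv, ha.symm, hb.symm, hp.symm]
    have hv0 : 0 ≤ v := by
      intro y
      rw [Finsupp.coe_zero, Pi.zero_apply]
      by_cases ha : y = a
      · rw [ha, hva]; linarith
      by_cases hb : y = b
      · rw [hb, hvb]; linarith
      by_cases hpy : y = p
      · rw [hpy, hvp]; exact hγ0.le
      rw [hvy y ha hb hpy]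
      exact hw0 y
    have hv1 : totalWeight v = 1 := by
      simp [hv, hw1]
    have hvx : weightedSum v = x := by
      have : p - (1 - τ) • a - τ • b = 0 := by rw [hp]; module
      simp only [hv, map_add, map_sub, map_smul, weightedSum_single, one_smul, this, smul_zero,
        add_zero, hwx]
    refine ⟨v.support, ⟨support_nonempty_of_totalWeight hv1, ?_, Or.inr ⟨?_, ?_⟩⟩,
      mem_convexHull_iff_weights.2 ⟨v, hv0, subset_rfl, hv1, hvx⟩⟩
    · simp only [Finsupp.mem_support_iff, not_and_or, not_not]
      rcases min_choice (w a / (1 - τ)) (w b / τ) with h | h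
      · left
        rw [hva, hγ, h, div_mul_cancel₀ _ h1'.ne', sub_self]
      · right
        rw [hvb, hγ, h, div_mul_cancel₀ _ h0.ne', sub_self]
    · rw [Finsupp.mem_support_iff, hvp]
      exact hγ0.ne'
    · refine T.down_closed hw (fun y hy => ?_) ⟨a, by simp⟩
      by_cases ha : y = a
      · rwa [ha]
      by_cases hb : y = b
      · rwa [hb]
      simp only [Finset.mem_union, Finset.mem_erase, Finset.mem_insert, Finset.mem_singleton,
        ha, hb, or_self, or_false, Finsupp.mem_support_iff] at hy
      rw [Finsupp.mem_support_iff, ← hvy y ha hb hy.1]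
      exact hy.2

/-- The stellar subdivision at an interior point of an edge exists. -/
lemma exists_edgeSubdivision (hT : T.faces.Finite) (hab : a ≠ b) {e : Finset E} (he : e ∈ T.faces)
    (ha : a ∈ e) (hb : b ∈ e) (h0 : 0 < τ) (h1 : τ < 1) (hp : p = (1 - τ) • a + τ • b) :
    ∃ T' : Geometry.SimplicialComplex ℝ E, T'.faces.Finite ∧ T'.space = T.space ∧
      (∀ s ∈ T'.faces, ∃ t ∈ T.faces, convexHull ℝ (s : Set E) ⊆ convexHull ℝ (t : Set E)) ∧
      ∀ s ∈ T'.faces, ¬(a ∈ s ∧ b ∈ s) ∧ (p ∉ s → s ∈ T.faces) := by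
  classical
  have hnp : ∀ s ∈ T.faces, p ∉ s := fun s hs =>
    notMem_face_of_edge_point hab he ha hb h0 h1 hp hs
  have hpa : p ≠ a := by rintro rfl; exact hnp _ he ha
  have hpb : p ≠ b := by rintro rfl; exact hnp _ he hb
  let T' := complexOfUniqueWeights (edgeSubdivisionFaces T a b p)
    (isRelLowerSet_edgeSubdivisionFaces T a b p)
    (edgeSubdivision_weights_unique hab hpa hpb hnp h0 h1 hp)
  have href : ∀ s ∈ T'.faces, ∃ t ∈ T.faces,
      convexHull ℝ (s : Set E) ⊆ convexHull ℝ (t : Set E) := by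
    rintro s ⟨-, -, h | ⟨-, h⟩⟩
    · exact ⟨s, h, subset_rfl⟩
    · refine ⟨_, h, convexHull_min (fun y hy => ?_) (convex_convexHull ℝ _)⟩
      by_cases hyp : y = p
      · have : segment ℝ a b ⊆ convexHull ℝ ((s.erase p ∪ {a, b} : Finset E) : Set E) :=
          segment_subset_convexHull (by simp) (by simp)
        exact this ⟨1 - τ, τ, by linarith, h0.le, by ring, by rw [hyp, hp]⟩
      · refine subset_convexHull ℝ _ ?_
        simp only [Finset.mem_coe] at hy
        simp [hyp, hy]
  refine ⟨T', ?_, ?_, href, ?_⟩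
  · refine (hT.biUnion fun t _ => (insert p t).powerset.finite_toSet).subset ?_
    rintro s ⟨-, -, h | ⟨-, h⟩⟩
    · exact mem_biUnion h (by simp)
    · refine mem_biUnion h ?_
      simp only [Finset.coe_powerset, mem_preimage, mem_powerset_iff, Finset.coe_subset]
      intro y hy
      by_cases hyp : y = p
      · simp [hyp]
      · simp [hyp, hy]
  · refine Subset.antisymm (fun x hx => ?_) fun x hx => ?_
    · obtain ⟨s, hs, hxs⟩ := T'.mem_space_iff.1 hx
      obtain ⟨t, ht, hst⟩ := href s hs
      exact T.mem_space_iff.2 ⟨t, ht, hst hxs⟩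
    · exact T'.mem_space_iff.2 (exists_edgeSubdivision_face_mem hab hnp h0 h1 hp hx)
  · rintro s ⟨-, hs, h⟩
    exact ⟨hs, fun hps => h.resolve_right fun h => hps h.1⟩

lemma exists_refinement_functional (ℓ : E →ᵃ[ℝ] ℝ) (T : Geometry.SimplicialComplex ℝ E)
    (hT : T.faces.Finite) :
    ∃ T' : Geometry.SimplicialComplex ℝ E, T'.faces.Finite ∧ T'.space = T.space ∧
      (∀ s ∈ T'.faces, ∃ t ∈ T.faces, convexHull ℝ (s : Set E) ⊆ convexHull ℝ (t : Set E)) ∧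
      ∀ s ∈ T'.faces, (∀ y ∈ s, 0 ≤ ℓ y) ∨ ∀ y ∈ s, ℓ y ≤ 0 := by
  classical
  let bad : Geometry.SimplicialComplex ℝ E → Set (E × E) := fun T =>
    {e | (∃ s ∈ T.faces, e.1 ∈ s ∧ e.2 ∈ s) ∧ ℓ e.1 < 0 ∧ 0 < ℓ e.2}
  have hfin : ∀ T : Geometry.SimplicialComplex ℝ E, T.faces.Finite → (bad T).Finite := by
    intro T hT
    refine (hT.biUnion fun t _ => (t ×ˢ t).finite_toSet).subset ?_
    rintro e ⟨⟨s, hs, h1, h2⟩, -⟩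
    exact mem_biUnion hs (by simp [h1, h2])
  induction hN : (bad T).ncard using Nat.strong_induction_on generalizing T with
  | _ N ih =>
  by_cases hbad : (bad T).Nonempty
  · obtain ⟨⟨a, b⟩, ⟨e, he, ha, hb⟩, hla, hlb⟩ := hbad
    simp only at ha hb hla hlb
    have hab : a ≠ b := by rintro rfl; linarith
    have hd : 0 < ℓ b - ℓ a := by linarith
    set τ := -ℓ a / (ℓ b - ℓ a) with hτ
    have h0 : 0 < τ := div_pos (by linarith) hd
    have h1 : τ < 1 := by rw [hτ, div_lt_one hd]; linarith
    set p := AffineMap.lineMap a b τ with hpdef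
    have hp : p = (1 - τ) • a + τ • b := by rw [hpdef, AffineMap.lineMap_apply_module]
    have hlp : ℓ p = 0 := by
      rw [hpdef, AffineMap.apply_lineMap, AffineMap.lineMap_apply_ring', hτ]
      field_simp
      ring
    obtain ⟨T₁, hT₁, hsp, href, hT₁s⟩ := exists_edgeSubdivision hT hab he ha hb h0 h1 hp
    have hlt : (bad T₁).ncard < N := by
      rw [← hN]
      refine ncard_lt_ncard ⟨?_, fun h => ?_⟩ (hfin T hT)
      · rintro ⟨c, d⟩ ⟨⟨s, hs, hc, hd⟩, hlc, hld⟩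
        simp only at hc hd hlc hld
        refine ⟨⟨{c, d}, (hT₁s {c, d} (T₁.down_closed hs ?_ (by simp))).2 ?_, by simp, by simp⟩,
          hlc, hld⟩
        · exact Finset.insert_subset hc (Finset.singleton_subset_iff.2 hd)
        · simp only [Finset.mem_insert, Finset.mem_singleton, not_or]
          constructor
          · rintro rfl; linarith
          · rintro rfl; linarith
      · obtain ⟨⟨s, hs, hc, hd⟩, -⟩ := h (show (a, b) ∈ bad T from ⟨⟨e, he, ha, hb⟩, hla, hlb⟩)
        exact (hT₁s s hs).1 ⟨hc, hd⟩
    obtain ⟨T₂, hT₂, hsp₂, href₂, hsign⟩ := ih _ hlt T₁ hT₁ rfl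
    refine ⟨T₂, hT₂, hsp₂.trans hsp, fun s hs => ?_, hsign⟩
    obtain ⟨t, ht, hst⟩ := href₂ s hs
    obtain ⟨t', ht', htt⟩ := href t ht
    exact ⟨t', ht', hst.trans htt⟩
  · refine ⟨T, hT, rfl, fun s hs => ⟨s, hs, subset_rfl⟩, fun s hs => ?_⟩
    by_contra! h
    obtain ⟨⟨a, ha, hla⟩, b, hb, hlb⟩ := h
    exact hbad ⟨(a, b), ⟨s, hs, ha, hb⟩, hla, hlb⟩

/-- A finite complex can be subdivided so that finitely many given affine functionals do not
change sign on any simplex. -/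
lemma exists_refinement (L : Finset (E →ᵃ[ℝ] ℝ)) (T : Geometry.SimplicialComplex ℝ E)
    (hT : T.faces.Finite) :
    ∃ T' : Geometry.SimplicialComplex ℝ E, T'.faces.Finite ∧ T'.space = T.space ∧
      (∀ s ∈ T'.faces, ∃ t ∈ T.faces, convexHull ℝ (s : Set E) ⊆ convexHull ℝ (t : Set E)) ∧
      ∀ ℓ ∈ L, ∀ s ∈ T'.faces, (∀ y ∈ convexHull ℝ (s : Set E), 0 ≤ ℓ y) ∨
        ∀ y ∈ convexHull ℝ (s : Set E), ℓ y ≤ 0 := by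
  classical
  induction L using Finset.induction_on with
  | empty => exact ⟨T, hT, rfl, fun s hs => ⟨s, hs, subset_rfl⟩, by simp⟩
  | insert ℓ L _ ih =>
    obtain ⟨T₁, hT₁, hsp, href, hsign⟩ := ih
    obtain ⟨T₂, hT₂, hsp₂, href₂, hsign₂⟩ := exists_refinement_functional ℓ T₁ hT₁
    refine ⟨T₂, hT₂, hsp₂.trans hsp, fun s hs => ?_, fun ℓ' hℓ' s hs => ?_⟩
    · obtain ⟨t, ht, hst⟩ := href₂ s hs
      obtain ⟨t', ht', htt⟩ := href t ht
      exact ⟨t', ht', hst.trans htt⟩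
    · rcases Finset.mem_insert.1 hℓ' with rfl | hℓ'
      · rcases hsign₂ s hs with h | h
        · left
          exact convexHull_min h ((convex_Ici (0 : ℝ)).affine_preimage ℓ')
        · right
          exact convexHull_min h ((convex_Iic (0 : ℝ)).affine_preimage ℓ')
      · obtain ⟨t, ht, hst⟩ := href₂ s hs
        exact (hsign ℓ' hℓ' t ht).imp (fun h y hy => h y (hst hy)) fun h y hy => h y (hst hy)

end Subdivision

end NobelingPL

namespace NobelingPL

section SignClasses

variable {V W Z : Type*} [AddCommGroup V] [Module ℝ V] [AddCommGroup W] [Module ℝ W]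
  [AddCommGroup Z] [Module ℝ Z]

/-- All functionals of `L` have the same signs at `x` and at `y`. -/
def SameSign (L : Finset (V →ᵃ[ℝ] ℝ)) (x y : V) : Prop :=
  ∀ ℓ ∈ L, SignType.sign (ℓ x) = SignType.sign (ℓ y)

lemma SameSign.mono {L L' : Finset (V →ᵃ[ℝ] ℝ)} {x y : V} (h : SameSign L' x y) (hL : L ⊆ L') :
    SameSign L x y := fun ℓ hℓ => h ℓ (hL hℓ)

/-- On each class of points of `S` at which finitely many affine functionals have the same signs,
`F` is affine. -/
def SignAffineOn (S : Set V) (F : V → W) : Prop :=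
  ∃ L : Finset (V →ᵃ[ℝ] ℝ), ∀ x ∈ S, ∃ g : V →ᵃ[ℝ] W, ∀ y ∈ S, SameSign L x y → F y = g y

/-- Membership in `A` of the points of `S` is determined by the signs of finitely many affine
functionals. -/
def SignDetermined (S A : Set V) : Prop :=
  ∃ L : Finset (V →ᵃ[ℝ] ℝ), ∀ x ∈ S, ∀ y ∈ S, SameSign L x y → x ∈ A → y ∈ A

lemma SignAffineOn.mono {S S' : Set V} {F : V → W} (h : SignAffineOn S' F) (hS : S ⊆ S') :
    SignAffineOn S F := by
  obtain ⟨L, hL⟩ := h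
  refine ⟨L, fun x hx => ?_⟩
  obtain ⟨g, hg⟩ := hL x (hS hx)
  exact ⟨g, fun y hy => hg y (hS hy)⟩

lemma SignDetermined.mono {S S' A : Set V} (h : SignDetermined S' A) (hS : S ⊆ S') :
    SignDetermined S A := by
  obtain ⟨L, hL⟩ := h
  exact ⟨L, fun x hx y hy => hL x (hS hx) y (hS hy)⟩

lemma SignAffineOn.congr {S : Set V} {F G : V → W} (h : SignAffineOn S F) (hFG : EqOn F G S) :
    SignAffineOn S G := by
  obtain ⟨L, hL⟩ := h
  refine ⟨L, fun x hx => ?_⟩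
  obtain ⟨g, hg⟩ := hL x hx
  exact ⟨g, fun y hy h => (hFG hy).symm.trans (hg y hy h)⟩

lemma signAffineOn_of_affine {S : Set V} {F : V → W} (g : V →ᵃ[ℝ] W) (h : ∀ x ∈ S, F x = g x) :
    SignAffineOn S F :=
  ⟨∅, fun _ _ => ⟨g, fun y hy _ => h y hy⟩⟩

/-- The affine pieces of `F` can be chosen in a finite family. -/
lemma SignAffineOn.exists_finite {S : Set V} {F : V → W} (h : SignAffineOn S F) :
    ∃ (L : Finset (V →ᵃ[ℝ] ℝ)) (G : Set (V →ᵃ[ℝ] W)), G.Finite ∧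
      ∀ x ∈ S, ∃ g ∈ G, ∀ y ∈ S, SameSign L x y → F y = g y := by
  classical
  obtain ⟨L, hL⟩ := h
  choose! g hg using hL
  let rep : (L → SignType) → V := fun ε =>
    if h : ∃ x ∈ S, (fun ℓ : L => SignType.sign (ℓ.1 x)) = ε then h.choose else 0
  refine ⟨L, range fun ε => g (rep ε), finite_range _, fun x hx => ?_⟩
  have hex : ∃ z ∈ S, (fun ℓ : L => SignType.sign (ℓ.1 z)) = fun ℓ : L => SignType.sign (ℓ.1 x) :=
    ⟨x, hx, rfl⟩
  refine ⟨_, ⟨fun ℓ : L => SignType.sign (ℓ.1 x), rfl⟩, fun y hy hxy => ?_⟩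
  simp only [rep, dif_pos hex]
  refine hg _ hex.choose_spec.1 y hy fun ℓ hℓ => ?_
  exact (congrFun hex.choose_spec.2 ⟨ℓ, hℓ⟩).trans (hxy ℓ hℓ)

lemma SignAffineOn.pullback {S : Set V} {F : V → W} (hF : SignAffineOn S F)
    (L' : Finset (W →ᵃ[ℝ] ℝ)) :
    ∃ L : Finset (V →ᵃ[ℝ] ℝ), ∀ x ∈ S, ∃ g : V →ᵃ[ℝ] W, ∀ y ∈ S, SameSign L x y →
      F y = g y ∧ SameSign L' (F x) (F y) := by
  classical
  obtain ⟨L, G, hG, hL⟩ := hF.exists_finite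
  refine ⟨L ∪ (L' ×ˢ hG.toFinset).image fun q => q.1.comp q.2, fun x hx => ?_⟩
  obtain ⟨g, hgG, hg⟩ := hL x hx
  refine ⟨g, fun y hy hxy => ?_⟩
  have hFx := hg x hx fun _ _ => rfl
  have hFy := hg y hy (hxy.mono Finset.subset_union_left)
  refine ⟨hFy, fun ℓ hℓ => ?_⟩
  have := hxy (ℓ.comp g) (Finset.mem_union_right _ (Finset.mem_image.2 ⟨(ℓ, g),
    Finset.mem_product.2 ⟨hℓ, hG.mem_toFinset.2 hgG⟩, rfl⟩))
  rw [hFx, hFy]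
  exact this

lemma SignAffineOn.comp {S : Set V} {S' : Set W} {F : V → W} {G : W → Z} (hG : SignAffineOn S' G)
    (hF : SignAffineOn S F) (hS : MapsTo F S S') : SignAffineOn S (fun x => G (F x)) := by
  obtain ⟨L', hL'⟩ := hG
  obtain ⟨L, hL⟩ := hF.pullback L'
  refine ⟨L, fun x hx => ?_⟩
  obtain ⟨g, hg⟩ := hL x hx
  obtain ⟨g', hg'⟩ := hL' (F x) (hS hx)
  refine ⟨g'.comp g, fun y hy hxy => ?_⟩
  obtain ⟨h1, h2⟩ := hg y hy hxy
  exact (hg' (F y) (hS hy) h2).trans (congrArg g' h1)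

lemma SignDetermined.preimage {S : Set V} {S' A : Set W} {F : V → W} (hA : SignDetermined S' A)
    (hF : SignAffineOn S F) (hS : MapsTo F S S') : SignDetermined S (F ⁻¹' A) := by
  obtain ⟨L', hL'⟩ := hA
  obtain ⟨L, hL⟩ := hF.pullback L'
  refine ⟨L, fun x hx y hy hxy hxA => ?_⟩
  obtain ⟨g, hg⟩ := hL x hx
  exact hL' (F x) (hS hx) (F y) (hS hy) (hg y hy hxy).2 hxA

lemma SignDetermined.compl {S A : Set V} (h : SignDetermined S A) : SignDetermined S Aᶜ := by
  obtain ⟨L, hL⟩ := h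
  exact ⟨L, fun x hx y hy hxy hxA hyA => hxA (hL y hy x hx (fun ℓ hℓ => (hxy ℓ hℓ).symm) hyA)⟩

lemma SignDetermined.biUnion {ι : Type*} {S : Set V} {I : Set ι} (hI : I.Finite) {A : ι → Set V}
    (h : ∀ i ∈ I, SignDetermined S (A i)) : SignDetermined S (⋃ i ∈ I, A i) := by
  classical
  choose! L hL using h
  refine ⟨hI.toFinset.biUnion L, fun x hx y hy hxy hxA => ?_⟩
  obtain ⟨i, hi, hxi⟩ := mem_iUnion₂.1 hxA
  exact mem_biUnion hi (hL i hi x hx y hy (hxy.mono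
    (Finset.subset_biUnion_of_mem L (hI.mem_toFinset.2 hi))) hxi)

/-- If `A` is determined on `S` and `A'` is determined on the part of `S` in `A`, then `A ∩ A'`
is determined on `S`. -/
lemma SignDetermined.inter {S A A' : Set V} (h : SignDetermined S A)
    (h' : SignDetermined (S ∩ A) A') : SignDetermined S (A ∩ A') := by
  classical
  obtain ⟨L, hL⟩ := h
  obtain ⟨L', hL'⟩ := h'
  refine ⟨L ∪ L', fun x hx y hy hxy hxA => ?_⟩
  have hyA := hL x hx y hy (hxy.mono Finset.subset_union_left) hxA.1
  exact ⟨hyA, hL' x ⟨hx, hxA.1⟩ y ⟨hy, hyA⟩ (hxy.mono Finset.subset_union_right) hxA.2⟩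

lemma signAffineOn_of_cover {ι : Type*} {S : Set V} {F : V → W} {I : Set ι} (hI : I.Finite)
    {A : ι → Set V} (hA : ∀ i ∈ I, SignDetermined S (A i)) (hS : S ⊆ ⋃ i ∈ I, A i)
    (hF : ∀ i ∈ I, SignAffineOn (S ∩ A i) F) : SignAffineOn S F := by
  classical
  choose! L hL using hA
  choose! L' hL' using hF
  refine ⟨hI.toFinset.biUnion fun i => L i ∪ L' i, fun x hx => ?_⟩
  obtain ⟨i, hi, hxi⟩ := mem_iUnion₂.1 (hS hx)
  obtain ⟨g, hg⟩ := hL' i hi x ⟨hx, hxi⟩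
  have hsub : L i ∪ L' i ⊆ hI.toFinset.biUnion fun i => L i ∪ L' i :=
    Finset.subset_biUnion_of_mem (fun i => L i ∪ L' i) (hI.mem_toFinset.2 hi)
  refine ⟨g, fun y hy hxy => ?_⟩
  have hxy' := hxy.mono hsub
  exact hg y ⟨hy, hL i hi x hx y hy (hxy'.mono Finset.subset_union_left) hxi⟩
    (hxy'.mono Finset.subset_union_right)

lemma signAffineOn_of_inter_compl {S A : Set V} {F : V → W} (hA : SignDetermined S A)
    (h : SignAffineOn (S ∩ A) F) (h' : SignAffineOn (S ∩ Aᶜ) F) : SignAffineOn S F := by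
  refine signAffineOn_of_cover (I := univ) (A := fun b : Bool => if b then A else Aᶜ) finite_univ
    (fun b _ => ?_) (fun x _ => ?_) fun b _ => ?_
  · cases b
    · simpa using hA.compl
    · simpa using hA
  · by_cases hx : x ∈ A
    · exact mem_biUnion (mem_univ true) (by simpa using hx)
    · exact mem_biUnion (mem_univ false) (by simpa using hx)
  · cases b
    · simpa using h'
    · simpa using h

lemma signDetermined_Iio (S : Set ℝ) (c : ℝ) : SignDetermined S (Iio c) := by
  refine ⟨{AffineMap.id ℝ ℝ - AffineMap.const ℝ ℝ c}, fun x _ y _ hxy hx => ?_⟩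
  have := hxy _ (Finset.mem_singleton_self _)
  simp only [AffineMap.coe_sub, AffineMap.coe_id, AffineMap.coe_const, Pi.sub_apply, id,
    Function.const_apply] at this
  rw [sign_neg (sub_neg.2 hx), eq_comm, sign_eq_neg_one_iff] at this
  exact sub_neg.1 this

/-- The distance to a point in the maximum norm is affine on sign classes. -/
lemma signAffineOn_norm_sub {ι : Type*} [Fintype ι] [Nonempty ι] (c : ι → ℝ) (S : Set (ι → ℝ)) :
    SignAffineOn S (fun u => ‖u - c‖) := by
  classical
  let d : ι → ((ι → ℝ) →ᵃ[ℝ] ℝ) := fun i =>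
    (LinearMap.proj (R := ℝ) (φ := fun _ : ι => ℝ) i).toAffineMap - AffineMap.const ℝ _ (c i)
  refine ⟨Finset.univ.image d ∪ (Finset.univ.image (fun q : ι × ι => d q.1 - d q.2) ∪
    Finset.univ.image fun q : ι × ι => d q.1 + d q.2), fun x _ => ?_⟩
  obtain ⟨i, -, hi⟩ := Finset.exists_max_image Finset.univ (fun i => |d i x|) Finset.univ_nonempty
  refine ⟨(SignType.sign (d i x) : ℝ) • d i, fun y _ hxy => ?_⟩
  have h1 : SignType.sign (d i x) = SignType.sign (d i y) := hxy _ (by simp)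
  have hmax : ∀ j, |d j y| ≤ |d i y| := by
    intro j
    have h2 : SignType.sign (d i x - d j x) = SignType.sign (d i y - d j y) :=
      hxy (d i - d j) (by simp)
    have h3 : SignType.sign (d i x + d j x) = SignType.sign (d i y + d j y) :=
      hxy (d i + d j) (by simp)
    have h4 : SignType.sign ((d i x - d j x) * (d i x + d j x)) =
        SignType.sign ((d i y - d j y) * (d i y + d j y)) := by
      rw [sign_mul, sign_mul, h2, h3]
    have h5 : 0 ≤ (d i x - d j x) * (d i x + d j x) := by
      have := sq_le_sq.2 (hi j (Finset.mem_univ j))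
      nlinarith
    have h6 : 0 ≤ (d i y - d j y) * (d i y + d j y) := by
      rwa [← sign_nonneg_iff, ← h4, sign_nonneg_iff]
    exact sq_le_sq.1 (by nlinarith)
  have hnorm : ‖y - c‖ = |d i y| := by
    refine le_antisymm ((pi_norm_le_iff_of_nonneg (abs_nonneg _)).2 hmax) ?_
    exact norm_le_pi_norm (y - c) i
  simp only [hnorm]
  rw [AffineMap.coe_smul, Pi.smul_apply, h1, smul_eq_mul, sign_mul_self]

lemma exists_affineMap_of_affineIndependent {ι : Type*} {p : ι → V} (hp : AffineIndependent ℝ p)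
    (c : ι → W) : ∃ g : V →ᵃ[ℝ] W, ∀ i, g (p i) = c i := by
  have hli : LinearIndependent ℝ fun i => (p i, (1 : ℝ)) := by
    rw [linearIndependent_iff']
    intro s w hw
    refine affineIndependent_iff.1 hp s w ?_ ?_
    · simpa [Prod.snd_sum] using congrArg Prod.snd hw
    · simpa [Prod.fst_sum] using congrArg Prod.fst hw
  obtain ⟨Λ, hΛ⟩ := LinearMap.exists_extend ((Finsupp.linearCombination ℝ c).comp hli.repr)
  refine ⟨Λ.toAffineMap.comp ((AffineMap.id ℝ V).prod (AffineMap.const ℝ V (1 : ℝ))), fun i => ?_⟩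
  have := LinearMap.congr_fun hΛ
    ⟨(p i, (1 : ℝ)), Submodule.subset_span (mem_range_self i)⟩
  rw [LinearMap.comp_apply, LinearMap.comp_apply, hli.repr_eq_single i _ rfl] at this
  simpa using this

/-- An affine map injective on a simplex has an affine left inverse there. -/
lemma exists_affine_leftInverse {s : Finset V} (hs : AffineIndependent ℝ ((↑) : s → V))
    (g : V →ᵃ[ℝ] W) (hg : InjOn g (convexHull ℝ (s : Set V))) :
    AffineIndependent ℝ (fun y : s => g y) ∧
      ∃ g' : W →ᵃ[ℝ] V, ∀ x ∈ convexHull ℝ (s : Set V), g' (g x) = x := by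
  classical
  have hind : AffineIndependent ℝ (fun y : s => g y) := by
    by_contra hnot
    obtain ⟨I, z, hz, hz'⟩ := Convex.radon_partition hnot
    have himg : ∀ J : Set s, convexHull ℝ ((fun y : s => g y) '' J) =
        g '' convexHull ℝ (((↑) : s → V) '' J) := by
      intro J
      rw [AffineMap.image_convexHull, image_image]
    have hsub : ∀ J : Set s, ((↑) : s → V) '' J ⊆ s := by
      rintro J _ ⟨y, -, rfl⟩
      exact y.2
    rw [himg] at hz hz'
    obtain ⟨x, hx, rfl⟩ := hz
    obtain ⟨x', hx', h⟩ := hz'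
    obtain rfl := hg (convexHull_mono (hsub _) hx') (convexHull_mono (hsub _) hx) h
    have hfin : ∀ J : Set s, ∃ t : Finset V, t ⊆ s ∧ (t : Set V) = ((↑) : s → V) '' J :=
      fun J => ⟨((toFinite (((↑) : s → V) '' J)).toFinset), by
        simpa [← Finset.coe_subset] using hsub J, by simp⟩
    obtain ⟨t₁, ht₁, e₁⟩ := hfin I
    obtain ⟨t₂, ht₂, e₂⟩ := hfin Iᶜ
    have hx'' : x' ∈ convexHull ℝ ((t₁ : Set V) ∩ t₂) := by
      rw [hs.convexHull_inter ht₁ ht₂, e₁, e₂]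
      exact ⟨hx, hx'⟩
    rw [e₁, e₂, ← image_inter Subtype.val_injective, inter_compl_self, image_empty,
      convexHull_empty] at hx''
    exact hx''
  refine ⟨hind, ?_⟩
  obtain ⟨g', hg'⟩ := exists_affineMap_of_affineIndependent hind fun y : s => (y : V)
  refine ⟨g', ?_⟩
  have hconv : Convex ℝ {x : V | (g'.comp g - AffineMap.id ℝ V) x = 0} :=
    (convex_singleton (0 : V)).affine_preimage (g'.comp g - AffineMap.id ℝ V)
  intro x hx
  have := convexHull_min (fun y hy => ?_) hconv hx
  · exact sub_eq_zero.1 this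
  · exact sub_eq_zero.2 (hg' ⟨y, hy⟩)

/-- Membership in a simplex is determined by signs, on a set of finite dimension. -/
lemma signDetermined_convexHull {s : Finset V} (hs : AffineIndependent ℝ ((↑) : s → V))
    (U : Submodule ℝ V) [FiniteDimensional ℝ U] :
    SignDetermined (U : Set V) (convexHull ℝ (s : Set V)) := by
  classical
  obtain ⟨μ, hμ⟩ := exists_affineMap_of_affineIndependent hs fun y : s => (Pi.single y 1 : s → ℝ)
  let π : (s → ℝ) →ₗ[ℝ] V := Fintype.linearCombination ℝ ((↑) : s → V)
  let R : V →ᵃ[ℝ] V := AffineMap.id ℝ V - π.toAffineMap.comp μ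
  let coord : s → (V →ᵃ[ℝ] ℝ) := fun y => (LinearMap.proj y).toAffineMap.comp μ
  let σ : V →ᵃ[ℝ] ℝ :=
    (∑ y : s, LinearMap.proj (R := ℝ) (φ := fun _ : s => ℝ) y).toAffineMap.comp μ -
      AffineMap.const ℝ V 1
  have hR : ∀ x, R x = x - ∑ y : s, μ x y • (y : V) := fun x => rfl
  have hσ : ∀ x, σ x = ∑ y : s, μ x y - 1 := fun x => by
    simp [σ]
  let U' : Submodule ℝ V := U ⊔ Submodule.span ℝ s
  have hRU : ∀ x ∈ U, R x ∈ U' := by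
    intro x hx
    refine U'.sub_mem (Submodule.mem_sup_left hx) (Submodule.mem_sup_right ?_)
    exact Submodule.sum_mem _ fun y _ => Submodule.smul_mem _ _ (Submodule.subset_span y.2)
  obtain ⟨e, he⟩ := LinearMap.exists_extend
    ((Module.finBasis ℝ U').equivFun : U' →ₗ[ℝ] (Fin (Module.finrank ℝ U') → ℝ))
  have he0 : ∀ z ∈ U', (∀ j, e z j = 0) → z = 0 := by
    intro z hz h
    have := LinearMap.congr_fun he ⟨z, hz⟩
    have h0 : (Module.finBasis ℝ U').equivFun ⟨z, hz⟩ = 0 := by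
      rw [← LinearEquiv.coe_coe, ← this]
      exact funext h
    exact congrArg Subtype.val ((LinearEquiv.map_eq_zero_iff _).1 h0)
  have hmem : ∀ x, x ∈ convexHull ℝ (s : Set V) ↔ (∀ y, 0 ≤ coord y x) ∧ σ x = 0 ∧ R x = 0 := by
    intro x
    constructor
    · have hconv : Convex ℝ {x | (∀ y, 0 ≤ coord y x) ∧ σ x = 0 ∧ R x = 0} := by
        have h1 : Convex ℝ (⋂ y, coord y ⁻¹' Ici 0) :=
          convex_iInter fun y => (convex_Ici (0 : ℝ)).affine_preimage (coord y)
        convert h1.inter (((convex_singleton (0 : ℝ)).affine_preimage σ).inter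
          ((convex_singleton (0 : V)).affine_preimage R)) using 1
        ext x
        simp
      intro hx
      refine convexHull_min (fun z hz => ?_) hconv hx
      have hz' : μ z = Pi.single ⟨z, hz⟩ 1 := hμ ⟨z, hz⟩
      refine ⟨fun y => ?_, ?_, ?_⟩
      · change 0 ≤ μ z y
        rw [hz', Pi.single_apply]
        split_ifs <;> simp
      · simp [hσ, hz']
      · rw [hR, hz', Finset.sum_eq_single ⟨z, hz⟩]
        · simp
        · intro y _ hy
          simp [hy]
        · simp
    · rintro ⟨h0, h1, h2⟩
      rw [hR, sub_eq_zero] at h2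
      rw [hσ, sub_eq_zero] at h1
      rw [h2]
      exact (convex_convexHull ℝ _).sum_mem (fun y _ => h0 y) h1
        fun y _ => subset_convexHull ℝ _ y.2
  refine ⟨Finset.univ.image coord ∪ ({σ} ∪ Finset.univ.image fun j =>
    (((LinearMap.proj (R := ℝ) (φ := fun _ => ℝ) j).comp e).toAffineMap.comp R)),
    fun x hx y hy hxy hxs => ?_⟩
  rw [hmem] at hxs ⊢
  obtain ⟨h0, h1, h2⟩ := hxs
  refine ⟨fun i => ?_, ?_, he0 _ (hRU y hy) fun j => ?_⟩
  · have := hxy (coord i) (by simp)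
    rw [← sign_nonneg_iff, ← this, sign_nonneg_iff]
    exact h0 i
  · have := hxy σ (by simp)
    rwa [h1, sign_zero, eq_comm, sign_eq_zero_iff] at this
  · have := hxy ((((LinearMap.proj (R := ℝ) (φ := fun _ => ℝ) j).comp e).toAffineMap.comp R))
      (by simp)
    have hz : ((((LinearMap.proj (R := ℝ) (φ := fun _ => ℝ) j).comp e).toAffineMap.comp R)) x
        = 0 := by
      simp [h2]
    rw [hz, sign_zero, eq_comm, sign_eq_zero_iff] at this
    exact this

end SignClasses

end NobelingPL

namespace NobelingPL

section Simplexwise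

variable {E W : Type*} [NormedAddCommGroup E] [NormedSpace ℝ E]
  [NormedAddCommGroup W] [NormedSpace ℝ W]

/-- `F` is affine on the simplexes of a finite triangulation of `B`. -/
def SimplexwiseAffineOn (B : Set E) (F : E → W) : Prop :=
  ∃ T : Geometry.SimplicialComplex ℝ E, T.faces.Finite ∧ T.space = B ∧
    ∀ s ∈ T.faces, ∃ g : E →ᵃ[ℝ] W, ∀ x ∈ convexHull ℝ (s : Set E), F x = g x

lemma affineMap_continuousOn_convexHull (s : Finset E) (g : E →ᵃ[ℝ] W) :
    ContinuousOn g (convexHull ℝ (s : Set E)) := by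
  have hsub : convexHull ℝ (s : Set E) ⊆ Submodule.span ℝ (s : Set E) :=
    convexHull_min Submodule.subset_span (Submodule.convex _)
  refine ContinuousOn.mono ?_ hsub
  rw [continuousOn_iff_continuous_domRestrict]
  have : (Submodule.span ℝ (s : Set E) : Set E).domRestrict g =
      fun x : Submodule.span ℝ (s : Set E) => (g.linear.domRestrict _) x + g 0 := by
    funext x
    simpa using congrFun g.decomp (x : E)
  rw [this]
  have hfd : FiniteDimensional ℝ (Submodule.span ℝ (s : Set E)) :=
    FiniteDimensional.span_finset ℝ s
  exact (LinearMap.continuous_of_finiteDimensional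
    (g.linear.domRestrict (Submodule.span ℝ (s : Set E)))).add continuous_const

lemma continuousOn_of_finite_hulls {ι : Type*} {I : Set ι} (hI : I.Finite) (s : ι → Finset E)
    {F : E → W} (hF : ∀ i ∈ I, ∃ g : E →ᵃ[ℝ] W, ∀ x ∈ convexHull ℝ (s i : Set E), F x = g x) :
    ContinuousOn F (⋃ i ∈ I, convexHull ℝ (s i : Set E)) := by
  have := hI.to_subtype
  rw [biUnion_eq_iUnion]
  refine (locallyFinite_of_finite _).continuousOn_iUnion (fun i => ?_) fun i => ?_
  · exact ((s i).finite_toSet.isClosed_convexHull ℝ)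
  · obtain ⟨g, hg⟩ := hF i i.2
    exact (affineMap_continuousOn_convexHull _ g).congr hg

lemma isCompact_space {T : Geometry.SimplicialComplex ℝ E} (hT : T.faces.Finite) :
    IsCompact T.space :=
  hT.isCompact_biUnion fun s _ => s.finite_toSet.isCompact_convexHull ℝ

lemma SimplexwiseAffineOn.continuousOn {B : Set E} {F : E → W} (h : SimplexwiseAffineOn B F) :
    ContinuousOn F B := by
  obtain ⟨T, hT, rfl, hF⟩ := h
  exact continuousOn_of_finite_hulls hT id hF

lemma SimplexwiseAffineOn.isCompact {B : Set E} {F : E → W} (h : SimplexwiseAffineOn B F) :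
    IsCompact B := by
  obtain ⟨T, hT, rfl, hF⟩ := h
  exact isCompact_space hT

lemma SimplexwiseAffineOn.exists_finite_family {B : Set E} {F : E → W}
    (h : SimplexwiseAffineOn B F) :
    ∃ G : Set (E →ᵃ[ℝ] W), G.Finite ∧ ∀ x ∈ B, ∃ g ∈ G, F x = g x := by
  obtain ⟨T, hT, rfl, hF⟩ := h
  choose! g hg using hF
  refine ⟨g '' T.faces, hT.image g, fun x hx => ?_⟩
  obtain ⟨s, hs, hxs⟩ := T.mem_space_iff.1 hx
  exact ⟨g s, mem_image_of_mem g hs, hg s hs x hxs⟩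

lemma exists_finiteDimensional_space {T : Geometry.SimplicialComplex ℝ E} (hT : T.faces.Finite) :
    ∃ U : Submodule ℝ E, FiniteDimensional ℝ U ∧ T.space ⊆ U := by
  have hfin : (⋃ s ∈ T.faces, (s : Set E)).Finite := hT.biUnion fun s _ => s.finite_toSet
  refine ⟨Submodule.span ℝ (⋃ s ∈ T.faces, (s : Set E)),
    FiniteDimensional.span_of_finite ℝ hfin, ?_⟩
  refine iUnion₂_subset fun s hs => convexHull_min ?_ (Submodule.convex _)
  exact (subset_biUnion_of_mem (u := fun s : Finset E => (s : Set E)) hs).trans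
    Submodule.subset_span

lemma SimplexwiseAffineOn.exists_finiteDimensional_image {B : Set E} {F : E → W}
    (h : SimplexwiseAffineOn B F) :
    ∃ U : Submodule ℝ W, FiniteDimensional ℝ U ∧ F '' B ⊆ U := by
  classical
  obtain ⟨T, hT, rfl, hF⟩ := h
  have hfin : (⋃ s ∈ T.faces, F '' (s : Set E)).Finite :=
    hT.biUnion fun s _ => s.finite_toSet.image F
  refine ⟨Submodule.span ℝ (⋃ s ∈ T.faces, F '' (s : Set E)),
    FiniteDimensional.span_of_finite ℝ hfin, ?_⟩
  rintro _ ⟨x, hx, rfl⟩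
  obtain ⟨s, hs, hxs⟩ := T.mem_space_iff.1 hx
  obtain ⟨g, hg⟩ := hF s hs
  rw [hg x hxs]
  have : g x ∈ convexHull ℝ (g '' s) := by
    rw [← AffineMap.image_convexHull]
    exact mem_image_of_mem g hxs
  refine convexHull_min ?_ (Submodule.convex _) this
  rintro _ ⟨y, hy, rfl⟩
  rw [← hg y (subset_convexHull ℝ _ hy)]
  exact Submodule.subset_span (mem_biUnion hs (mem_image_of_mem F hy))

/-- A continuous map affine on sign classes preserves simplexwise affine maps. -/
lemma SimplexwiseAffineOn.comp {Z : Type*} [NormedAddCommGroup Z] [NormedSpace ℝ Z]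
    {B : Set E} {F : E → W} {h : W → Z} (hF : SimplexwiseAffineOn B F)
    (hh : SignAffineOn (F '' B) h) (hc : ContinuousOn h (F '' B)) :
    SimplexwiseAffineOn B (fun x => h (F x)) := by
  classical
  obtain ⟨T, hT, rfl, hF⟩ := hF
  obtain ⟨L, hL⟩ := hh
  choose! g hg using hF
  obtain ⟨T', hT', hsp, href, hsign⟩ := exists_refinement
    ((L ×ˢ hT.toFinset).image fun q => q.1.comp (g q.2)) T hT
  refine ⟨T', hT', hsp, fun t ht => ?_⟩
  obtain ⟨s, hs, hts⟩ := href t ht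
  have hne := T'.nonempty_of_mem_faces ht
  set c := t.centroid ℝ id with hcdef
  have hct : c ∈ convexHull ℝ (t : Set E) := t.centroid_mem_convexHull hne
  have hspace : ∀ x ∈ convexHull ℝ (t : Set E), x ∈ T.space := fun x hx =>
    T.mem_space_iff.2 ⟨s, hs, hts hx⟩
  obtain ⟨g', hg'⟩ := hL (F c) (mem_image_of_mem F (hspace c hct))
  -- a functional without sign changes that vanishes at the barycentre vanishes on the simplex
  have hzero : ∀ ℓ : E →ᵃ[ℝ] ℝ, (∀ y ∈ convexHull ℝ (t : Set E), 0 ≤ ℓ y) → ℓ c = 0 →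
      ∀ y ∈ convexHull ℝ (t : Set E), ℓ y = 0 := by
    intro ℓ hℓ hℓc
    have hsum : ∑ y ∈ t, ℓ y = 0 := by
      have hw : ∑ i ∈ t, t.centroidWeights ℝ i = 1 :=
        t.sum_centroidWeights_eq_one_of_nonempty ℝ hne
      rw [hcdef, Finset.centroid_def, Finset.map_affineCombination _ _ _ hw,
        Finset.affineCombination_eq_linear_combination _ _ _ hw] at hℓc
      simp only [Finset.centroidWeights_apply, Function.comp_apply, id, smul_eq_mul] at hℓc
      rw [← Finset.mul_sum] at hℓc
      refine (mul_eq_zero.1 hℓc).resolve_left ?_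
      simpa using hne.ne_empty
    have hv := (Finset.sum_eq_zero_iff_of_nonneg
      fun y hy => hℓ y (subset_convexHull ℝ _ hy)).1 hsum
    exact convexHull_min hv ((convex_singleton (0 : ℝ)).affine_preimage ℓ)
  have hsame : ∀ x ∈ convexHull ℝ (t : Set E), ∀ τ : ℝ, 0 < τ → τ ≤ 1 →
      SameSign L (F c) (F (AffineMap.lineMap x c τ)) := by
    intro x hx τ h0 h1 ℓ hℓ
    have hxτ : AffineMap.lineMap x c τ ∈ convexHull ℝ (t : Set E) :=
      (convex_convexHull ℝ _).lineMap_mem hx hct ⟨h0.le, h1⟩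
    rw [hg s hs _ (hts hct), hg s hs _ (hts hxτ)]
    have key : ∀ k : E →ᵃ[ℝ] ℝ, (∀ y ∈ convexHull ℝ (t : Set E), 0 ≤ k y) →
        SignType.sign (k c) = SignType.sign (k (AffineMap.lineMap x c τ)) := by
      intro k hk
      rcases (hk c hct).eq_or_lt with h | h
      · rw [← h, hzero k hk h.symm _ hxτ]
      · rw [sign_pos h, sign_pos]
        rw [AffineMap.apply_lineMap, AffineMap.lineMap_apply_ring]
        have := hk x hx
        nlinarith [mul_pos h0 h, mul_nonneg (sub_nonneg.2 h1) this]
    rcases hsign (ℓ.comp (g s)) (Finset.mem_image.2 ⟨(ℓ, s), Finset.mem_product.2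
      ⟨hℓ, hT.mem_toFinset.2 hs⟩, rfl⟩) t ht with h | h
    · exact key _ h
    · have := key (-(ℓ.comp (g s))) fun y hy => neg_nonneg.2 (h y hy)
      simp only [AffineMap.coe_neg, Pi.neg_apply, Left.sign_neg, neg_inj] at this
      exact this
  refine ⟨g'.comp (g s), fun x hx => ?_⟩
  have hlineF : ∀ τ : ℝ, 0 < τ → τ ≤ 1 →
      F (AffineMap.lineMap x c τ) = AffineMap.lineMap (F x) (F c) τ := by
    intro τ h0 h1
    rw [hg s hs _ (hts ((convex_convexHull ℝ _).lineMap_mem hx hct ⟨h0.le, h1⟩)),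
      hg s hs _ (hts hx), hg s hs _ (hts hct), AffineMap.apply_lineMap]
  have hIoc : Ioc (0 : ℝ) 1 ∈ 𝓝[>] (0 : ℝ) := Ioc_mem_nhdsGT one_pos
  have hlim : Filter.Tendsto (fun τ : ℝ => AffineMap.lineMap (F x) (F c) τ) (𝓝[>] 0)
      (𝓝 (F x)) := by
    have : Continuous fun τ : ℝ => AffineMap.lineMap (F x) (F c) τ :=
      AffineMap.lineMap_continuous
    simpa using (this.tendsto 0).mono_left nhdsWithin_le_nhds
  have hlimF : Filter.Tendsto (fun τ : ℝ => F (AffineMap.lineMap x c τ)) (𝓝[>] 0)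
      (𝓝[F '' T.space] (F x)) := by
    refine tendsto_nhdsWithin_iff.2 ⟨hlim.congr' ?_, ?_⟩
    · filter_upwards [hIoc] with τ hτ using (hlineF τ hτ.1 hτ.2).symm
    · filter_upwards [hIoc] with τ hτ
      exact mem_image_of_mem F (hspace _
        ((convex_convexHull ℝ _).lineMap_mem hx hct ⟨hτ.1.le, hτ.2⟩))
  have hlim1 := (hc (F x) (mem_image_of_mem F (hspace x hx))).tendsto.comp hlimF
  have hlim2 : Filter.Tendsto (fun τ : ℝ => AffineMap.lineMap (g' (F x)) (g' (F c)) τ) (𝓝[>] 0)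
      (𝓝 (g' (F x))) := by
    have : Continuous fun τ : ℝ => AffineMap.lineMap (g' (F x)) (g' (F c)) τ :=
      AffineMap.lineMap_continuous
    simpa using (this.tendsto 0).mono_left nhdsWithin_le_nhds
  have heq : h (F x) = g' (F x) := by
    refine tendsto_nhds_unique hlim1 (hlim2.congr' ?_)
    filter_upwards [hIoc] with τ hτ
    rw [Function.comp_apply, hg' _ (mem_image_of_mem F (hspace _
      ((convex_convexHull ℝ _).lineMap_mem hx hct ⟨hτ.1.le, hτ.2⟩))) (hsame x hx τ hτ.1 hτ.2),
      hlineF τ hτ.1 hτ.2, AffineMap.apply_lineMap]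
  rw [AffineMap.comp_apply, ← hg s hs x (hts hx)]
  exact heq

end Simplexwise

section Thin

variable {V W : Type*} [AddCommGroup V] [Module ℝ V] [AddCommGroup W] [Module ℝ W]

/-- `S` is covered by countably many affine subspaces of dimension at most `d`. -/
def IsThin (d : ℕ) (S : Set V) : Prop :=
  ∃ A : Set (AffineSubspace ℝ V), A.Countable ∧
    (∀ P ∈ A, FiniteDimensional ℝ P.direction ∧ Module.finrank ℝ P.direction ≤ d) ∧
    S ⊆ ⋃ P ∈ A, (P : Set V)

lemma IsThin.mono {d : ℕ} {S S' : Set V} (h : IsThin d S') (hS : S ⊆ S') : IsThin d S := by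
  obtain ⟨A, hA, hd, hsub⟩ := h
  exact ⟨A, hA, hd, hS.trans hsub⟩

lemma IsThin.image {d : ℕ} {S : Set V} (h : IsThin d S) {F : V → W} {G : Set (V →ᵃ[ℝ] W)}
    (hG : G.Countable) (hF : ∀ x ∈ S, ∃ g ∈ G, F x = g x) : IsThin d (F '' S) := by
  obtain ⟨A, hA, hd, hsub⟩ := h
  refine ⟨image2 (fun P g => P.map g) A G, hA.image2 hG _, ?_, ?_⟩
  · rintro _ ⟨P, hP, g, -, rfl⟩
    have := (hd P hP).1
    rw [AffineSubspace.map_direction]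
    exact ⟨inferInstance, (Submodule.finrank_map_le _ _).trans (hd P hP).2⟩
  · rintro _ ⟨x, hx, rfl⟩
    obtain ⟨P, hP, hxP⟩ := mem_iUnion₂.1 (hsub hx)
    obtain ⟨g, hg, hgx⟩ := hF x hx
    rw [hgx]
    exact mem_biUnion (mem_image2_of_mem hP hg) (AffineSubspace.mem_map_of_mem g hxP)

lemma IsThin.image_signAffineOn {d : ℕ} {S : Set V} (h : IsThin d S) {F : V → W}
    (hF : SignAffineOn S F) : IsThin d (F '' S) := by
  obtain ⟨L, G, hG, hL⟩ := hF.exists_finite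
  refine h.image hG.countable fun x hx => ?_
  obtain ⟨g, hg, hgx⟩ := hL x hx
  exact ⟨g, hg, hgx x hx fun _ _ => rfl⟩

lemma isThin_stdSimplex (q : ℕ) : IsThin q (stdSimplex ℝ (Fin (q + 1))) := by
  refine ⟨{affineSpan ℝ (range fun i : Fin (q + 1) => (Pi.single i 1 : Fin (q + 1) → ℝ))},
    countable_singleton _, ?_, ?_⟩
  · rintro _ rfl
    rw [direction_affineSpan]
    exact ⟨inferInstance, finrank_vectorSpan_range_le ℝ _ (by simp)⟩
  · rw [biUnion_singleton, ← convexHull_rangle_single_eq_stdSimplex]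
    exact convexHull_subset_affineSpan _

end Thin

end NobelingPL

namespace NobelingPL

section Chart

variable {V W : Type*} [NormedAddCommGroup V] [NormedSpace ℝ V]
  [NormedAddCommGroup W] [NormedSpace ℝ W]

/-- `Φ` and `Ψ` are mutually inverse piecewise linear bijections between the compact polyhedron `N`
and the set `C`. -/
structure IsPLChart (N : Set V) (C : Set W) (Φ : V → W) (Ψ : W → V) : Prop where
  mapsTo : MapsTo Φ N C
  mapsTo_symm : MapsTo Ψ C N
  left_inv : LeftInvOn Ψ Φ N
  right_inv : LeftInvOn Φ Ψ C
  isCompact : IsCompact N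
  continuousOn : ContinuousOn Φ N
  continuousOn_symm : ContinuousOn Ψ C
  signDetermined : ∀ U : Submodule ℝ V, FiniteDimensional ℝ U → SignDetermined (U : Set V) N
  signAffineOn : SignAffineOn N Φ
  signAffineOn_inter : ∀ U : Submodule ℝ V, FiniteDimensional ℝ U → SignAffineOn (U ∩ N) Φ
  signAffineOn_symm : SignAffineOn C Ψ

lemma exists_isPLChart [FiniteDimensional ℝ W] {N : Set V} {C : Set W} {φ : N → C}
    (hφ : IsPLMap φ) (hbij : Function.Bijective φ) :
    ∃ (Φ : V → W) (Ψ : W → V), IsPLChart N C Φ Ψ ∧ ∀ x : N, Φ x = φ x := by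
  classical
  obtain ⟨T, hT, rfl, hg⟩ := hφ
  choose! g hg using hg
  let e := Equiv.ofBijective φ hbij
  let Φ : V → W := fun x => if hx : x ∈ T.space then φ ⟨x, hx⟩ else 0
  let Ψ : W → V := fun w => if hw : w ∈ C then e.symm ⟨w, hw⟩ else 0
  have hΦ : ∀ x : T.space, Φ x = φ x := fun x => by simp only [Φ, dif_pos x.2]
  have hΨ : ∀ w : C, Ψ w = e.symm w := fun w => by simp only [Ψ, dif_pos w.2]
  have hmaps : MapsTo Φ T.space C := fun x hx => by
    rw [hΦ ⟨x, hx⟩]; exact (φ ⟨x, hx⟩).2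
  have hmaps' : MapsTo Ψ C T.space := fun w hw => by
    rw [hΨ ⟨w, hw⟩]; exact (e.symm ⟨w, hw⟩).2
  have hleft : LeftInvOn Ψ Φ T.space := fun x hx => by
    rw [hΦ ⟨x, hx⟩, hΨ]
    exact congrArg Subtype.val (e.symm_apply_apply ⟨x, hx⟩)
  have hright : LeftInvOn Φ Ψ C := fun w hw => by
    rw [hΨ ⟨w, hw⟩, hΦ]
    exact congrArg Subtype.val (e.apply_symm_apply ⟨w, hw⟩)
  have hsub : ∀ s ∈ T.faces, convexHull ℝ (s : Set V) ⊆ T.space := fun s hs =>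
    T.convexHull_subset_space hs
  have hgΦ : ∀ s ∈ T.faces, ∀ x ∈ convexHull ℝ (s : Set V), Φ x = g s x := fun s hs x hx => by
    rw [hΦ ⟨x, hsub s hs hx⟩]
    exact hg s hs ⟨x, hsub s hs hx⟩ hx
  have hinv : ∀ s ∈ T.faces, AffineIndependent ℝ (fun y : s => g s y) ∧
      ∃ g' : W →ᵃ[ℝ] V, ∀ x ∈ convexHull ℝ (s : Set V), g' (g s x) = x := by
    intro s hs
    refine exists_affine_leftInverse (T.indep hs) (g s) fun x hx y hy hxy => ?_
    rw [← hgΦ s hs x hx, ← hgΦ s hs y hy] at hxy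
    exact hleft.injOn (hsub s hs hx) (hsub s hs hy) hxy
  have himg : ∀ s ∈ T.faces, convexHull ℝ ((s.image (g s) : Finset W) : Set W) =
      Φ '' convexHull ℝ (s : Set V) := by
    intro s hs
    rw [Finset.coe_image, ← AffineMap.image_convexHull]
    exact image_congr fun x hx => (hgΦ s hs x hx).symm
  have hcover : C = ⋃ s ∈ T.faces, convexHull ℝ ((s.image (g s) : Finset W) : Set W) := by
    refine Subset.antisymm (fun w hw => ?_) (iUnion₂_subset fun s hs => ?_)
    · obtain ⟨s, hs, hws⟩ := T.mem_space_iff.1 (hmaps' hw)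
      refine mem_biUnion hs ?_
      rw [himg s hs]
      exact ⟨Ψ w, hws, hright hw⟩
    · rw [himg s hs]
      rintro _ ⟨x, hx, rfl⟩
      exact hmaps (hsub s hs hx)
  have hΨaff : ∀ s ∈ T.faces, ∃ g' : W →ᵃ[ℝ] V,
      ∀ w ∈ convexHull ℝ ((s.image (g s) : Finset W) : Set W), Ψ w = g' w := by
    intro s hs
    obtain ⟨-, g', hg'⟩ := hinv s hs
    refine ⟨g', fun w hw => ?_⟩
    rw [himg s hs] at hw
    obtain ⟨x, hx, rfl⟩ := hw
    rw [hleft (hsub s hs hx), hgΦ s hs x hx, hg' x hx]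
  have hsignΦ : ∀ U : Submodule ℝ V, FiniteDimensional ℝ U → SignAffineOn (U ∩ T.space) Φ := by
    intro U _
    refine signAffineOn_of_cover (A := fun s : Finset V => convexHull ℝ (s : Set V)) hT
      (fun s hs => (signDetermined_convexHull (T.indep hs) U).mono inter_subset_left)
      (fun x hx => hx.2) fun s hs => signAffineOn_of_affine (g s) fun x hx => hgΦ s hs x hx.2
  obtain ⟨U₀, hU₀, hTU₀⟩ := exists_finiteDimensional_space hT
  refine ⟨Φ, Ψ, ⟨hmaps, hmaps', hleft, hright, isCompact_space hT, ?_, ?_, ?_, ?_, hsignΦ, ?_⟩, hΦ⟩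
  · exact continuousOn_of_finite_hulls hT id fun s hs => ⟨g s, hgΦ s hs⟩
  · rw [hcover]
    exact continuousOn_of_finite_hulls hT _ hΨaff
  · intro U _
    exact SignDetermined.biUnion hT fun s hs => signDetermined_convexHull (T.indep hs) U
  · exact (hsignΦ U₀ hU₀).mono fun x hx => ⟨hTU₀ hx, hx⟩
  · refine signAffineOn_of_cover hT (fun s hs => ?_) hcover.subset fun s hs => ?_
    · have hind : AffineIndependent ℝ
          ((↑) : ((s.image (g s) : Finset W) : Set W) → W) := by
        have := (hinv s hs).1.range
        have hr : range (fun y : s => g s y) = ((s.image (g s) : Finset W) : Set W) := by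
          ext w
          simp
        rwa [hr] at this
      have := signDetermined_convexHull (s := s.image (g s)) hind (⊤ : Submodule ℝ W)
      exact this.mono (subset_univ _)
    · obtain ⟨g', hg'⟩ := hΨaff s hs
      exact signAffineOn_of_affine g' fun w hw => hg' w hw.2

end Chart

section GeneralPosition

variable {V : Type*} [NormedAddCommGroup V] [NormedSpace ℝ V]

/-- The displacements carrying a point of `A` into `C` form a set of dimension at most the sum
of the dimensions of `A` and `C`. -/
lemma dimH_displacement_le {d d' : ℕ} [FiniteDimensional ℝ V] (A C : AffineSubspace ℝ V)
    (hA : Module.finrank ℝ A.direction ≤ d) (hC : Module.finrank ℝ C.direction ≤ d')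
    (c : V) (δ : ℝ) :
    dimH {v : V | ∃ u ∈ A, ‖u - c‖ < δ ∧ u + (δ - ‖u - c‖) • v ∈ C} ≤ (d + d' : ℕ) := by
  rcases (A : Set V).eq_empty_or_nonempty with hAe | ⟨a, ha⟩
  · have : {v : V | ∃ u ∈ A, ‖u - c‖ < δ ∧ u + (δ - ‖u - c‖) • v ∈ C} = ∅ := by
      refine eq_empty_of_forall_notMem ?_
      rintro v ⟨u, hu, -⟩
      exact (hAe ▸ (show u ∈ (A : Set V) from hu) : u ∈ (∅ : Set V))
    rw [this, dimH_empty]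
    exact zero_le
  rcases (C : Set V).eq_empty_or_nonempty with hCe | ⟨z₀, hz₀⟩
  · have : {v : V | ∃ u ∈ A, ‖u - c‖ < δ ∧ u + (δ - ‖u - c‖) • v ∈ C} = ∅ := by
      refine eq_empty_of_forall_notMem ?_
      rintro v ⟨u, -, -, hv⟩
      exact (hCe ▸ (show _ ∈ (C : Set V) from hv) : _ ∈ (∅ : Set V))
    rw [this, dimH_empty]
    exact zero_le
  let P : A.direction × C.direction → ℝ × V := fun q =>
    (δ - ‖a + (q.1 : V) - c‖, (z₀ + (q.2 : V)) - (a + (q.1 : V)))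
  have hP : ∃ κ, LipschitzWith κ P := by
    have h1 : LipschitzWith 1 fun q : A.direction × C.direction => (q.1 : V) :=
      (LipschitzWith.subtype_val _).comp LipschitzWith.prod_fst |>.weaken (by simp)
    have h2 : LipschitzWith 1 fun q : A.direction × C.direction => (q.2 : V) :=
      (LipschitzWith.subtype_val _).comp LipschitzWith.prod_snd |>.weaken (by simp)
    have h3 := (LipschitzWith.const a).add h1
    have h4 := (LipschitzWith.const δ).sub
      (lipschitzWith_one_norm.comp (h3.sub (LipschitzWith.const c)))
    have h5 := ((LipschitzWith.const z₀).add h2).sub h3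
    exact ⟨_, h4.prodMk h5⟩
  obtain ⟨κ, hP⟩ := hP
  have hdimP : dimH (range P) ≤ (d + d' : ℕ) := by
    refine hP.dimH_range_le.trans ?_
    rw [Real.dimH_univ_eq_finrank, Module.finrank_prod]
    exact_mod_cast add_le_add hA hC
  let Q : ℝ × V → V := fun r => r.1⁻¹ • r.2
  have hQ : ContDiffOn ℝ 1 Q {r | 0 < r.1} := by
    intro r hr
    refine ContDiffWithinAt.smul ?_ contDiffWithinAt_snd
    exact contDiffWithinAt_fst.inv (ne_of_gt hr)
  have hconv : Convex ℝ {r : ℝ × V | 0 < r.1} :=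
    (convex_Ioi (0 : ℝ)).linear_preimage (LinearMap.fst ℝ ℝ V)
  have hsub : {v : V | ∃ u ∈ A, ‖u - c‖ < δ ∧ u + (δ - ‖u - c‖) • v ∈ C} ⊆
      Q '' (range P ∩ {r | 0 < r.1}) := by
    rintro v ⟨u, hu, hlt, hv⟩
    have hpos : 0 < δ - ‖u - c‖ := sub_pos.2 hlt
    refine ⟨(δ - ‖u - c‖, (u + (δ - ‖u - c‖) • v) - u), ⟨⟨(⟨u - a, A.vsub_mem_direction hu ha⟩,
      ⟨(u + (δ - ‖u - c‖) • v) - z₀, C.vsub_mem_direction hv hz₀⟩), ?_⟩, hpos⟩, ?_⟩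
    · simp only [P, add_sub_cancel]
    · simp only [Q, add_sub_cancel_left]
      rw [smul_smul, inv_mul_cancel₀ hpos.ne', one_smul]
  calc _ ≤ dimH (Q '' (range P ∩ {r | 0 < r.1})) := dimH_mono hsub
    _ ≤ dimH (range P ∩ {r | 0 < r.1}) := hQ.dimH_image_le hconv inter_subset_right
    _ ≤ dimH (range P) := dimH_mono inter_subset_left
    _ ≤ _ := hdimP

/-- Arbitrarily small displacements tangent to the standard simplex move a thin set off another
thin set of complementary dimension. -/
lemma exists_small_displacement {m d d' : ℕ} (hd : d + d' < m) {S S' : Set (Fin (m + 1) → ℝ)}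
    (hS : IsThin d S) (hS' : IsThin d' S') (c : Fin (m + 1) → ℝ) (δ : ℝ) {r : ℝ} (hr : 0 < r) :
    ∃ v : Fin (m + 1) → ℝ, ∑ i, v i = 0 ∧ ‖v‖ < r ∧
      ∀ u ∈ S, ‖u - c‖ < δ → u + (δ - ‖u - c‖) • v ∉ S' := by
  obtain ⟨A, hA, hAd, hSA⟩ := hS
  obtain ⟨C, hC, hCd, hSC⟩ := hS'
  let σ : (Fin (m + 1) → ℝ) →ₗ[ℝ] ℝ := ∑ i, LinearMap.proj i
  have hσ : ∀ v, σ v = ∑ i, v i := fun v => by simp [σ]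
  have hrank : Module.finrank ℝ (LinearMap.ker σ) = m := by
    have hne : σ ≠ 0 := by
      intro h
      have := hσ (Pi.single 0 1)
      simp [h] at this
    have hsurj : LinearMap.range σ = ⊤ :=
      LinearMap.range_eq_top.2 (LinearMap.surjective_of_ne_zero hne)
    have := LinearMap.finrank_range_add_finrank_ker σ
    rw [hsurj, finrank_top, Module.finrank_self, Module.finrank_fin_fun] at this
    omega
  let bad : Set (Fin (m + 1) → ℝ) := ⋃ P ∈ A, ⋃ R ∈ C,
    {v | ∃ u ∈ P, ‖u - c‖ < δ ∧ u + (δ - ‖u - c‖) • v ∈ R}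
  have hbad : dimH bad ≤ (d + d' : ℕ) := by
    rw [dimH_bUnion hA]
    refine iSup₂_le fun P hP => ?_
    rw [dimH_bUnion hC]
    exact iSup₂_le fun R hR => dimH_displacement_le P R (hAd P hP).2 (hCd R hR).2 c δ
  let bad' : Set (LinearMap.ker σ) := (↑) ⁻¹' bad
  have hbad' : dimH bad' < Module.finrank ℝ (LinearMap.ker σ) := by
    have h1 : dimH bad' ≤ dimH bad := by
      rw [← (isometry_subtype_coe (s := (LinearMap.ker σ : Set (Fin (m + 1) → ℝ)))).dimH_image]
      exact dimH_mono (image_preimage_subset _ _)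
    rw [hrank]
    exact (h1.trans hbad).trans_lt (by exact_mod_cast hd)
  obtain ⟨v, hv, hvr⟩ := (dense_compl_of_dimH_lt_finrank hbad').exists_mem_open Metric.isOpen_ball
    ⟨0, Metric.mem_ball_self hr⟩
  refine ⟨v, ?_, ?_, fun u hu hlt hmem => ?_⟩
  · rw [← hσ]
    exact v.2
  · simpa using hvr
  · obtain ⟨P, hP, huP⟩ := mem_iUnion₂.1 (hSA hu)
    obtain ⟨R, hR, huR⟩ := mem_iUnion₂.1 (hSC hmem)
    exact hv (mem_biUnion hP (mem_biUnion hR ⟨u, huP, hlt, huR⟩))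

end GeneralPosition

end NobelingPL

namespace NobelingPL

section Push

variable {V : Type*} [NormedAddCommGroup V] [NormedSpace ℝ V] {m : ℕ}

open Classical in
/-- The map that in the chart `Φ` displaces `u` by `(δ - ‖u - c‖) • v` inside the ball of centre `c`
and radius `δ`, and is the identity elsewhere. -/
noncomputable def pushMap (N : Set V) (Φ : V → Fin (m + 1) → ℝ) (Ψ : (Fin (m + 1) → ℝ) → V)
    (c : Fin (m + 1) → ℝ) (δ : ℝ) (v : Fin (m + 1) → ℝ) (y : V) : V :=
  if y ∈ N ∧ ‖Φ y - c‖ < δ then Ψ (Φ y + (δ - ‖Φ y - c‖) • v) else y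

lemma displacement_mem {c : Fin (m + 1) → ℝ} {δ : ℝ} (hδ : ∀ i, δ ≤ c i) {v : Fin (m + 1) → ℝ}
    (hv0 : ∑ i, v i = 0) (hv1 : ‖v‖ < 1) {u : Fin (m + 1) → ℝ}
    (hu : u ∈ stdSimplex ℝ (Fin (m + 1))) (huc : ‖u - c‖ < δ) :
    u + (δ - ‖u - c‖) • v ∈ stdSimplex ℝ (Fin (m + 1)) ∧
      ‖u + (δ - ‖u - c‖) • v - c‖ < δ ∧ ∀ i, 0 < (u + (δ - ‖u - c‖) • v) i := by
  have hpos : 0 < δ - ‖u - c‖ := sub_pos.2 huc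
  have hnorm : ‖u + (δ - ‖u - c‖) • v - c‖ < δ := by
    calc ‖u + (δ - ‖u - c‖) • v - c‖ = ‖(u - c) + (δ - ‖u - c‖) • v‖ := by congr 1; abel
      _ ≤ ‖u - c‖ + (δ - ‖u - c‖) * ‖v‖ := by
        refine (norm_add_le _ _).trans ?_
        rw [norm_smul, Real.norm_of_nonneg hpos.le]
      _ < δ := by nlinarith [mul_lt_mul_of_pos_left hv1 hpos]
  have hcoord : ∀ i, 0 < (u + (δ - ‖u - c‖) • v) i := by
    intro i
    have h1 := norm_le_pi_norm (u + (δ - ‖u - c‖) • v - c) i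
    rw [Pi.sub_apply, Real.norm_eq_abs] at h1
    have h2 := (abs_lt.1 (h1.trans_lt hnorm)).1
    linarith [hδ i]
  refine ⟨⟨fun i => (hcoord i).le, ?_⟩, hnorm, hcoord⟩
  simp only [Pi.add_apply, Pi.smul_apply, smul_eq_mul, Finset.sum_add_distrib, ← Finset.mul_sum,
    hv0, mul_zero, add_zero]
  exact hu.2

lemma displacement_injective {c : Fin (m + 1) → ℝ} {δ : ℝ} {v : Fin (m + 1) → ℝ} (hv1 : ‖v‖ < 1)
    {u u' : Fin (m + 1) → ℝ} (h : u + (δ - ‖u - c‖) • v = u' + (δ - ‖u' - c‖) • v) : u = u' := by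
  by_contra hne
  have hd : u - u' = (‖u - c‖ - ‖u' - c‖) • v := by
    have h1 : u - u' = (δ - ‖u' - c‖) • v - (δ - ‖u - c‖) • v :=
      sub_eq_sub_iff_add_eq_add.2 (h.trans (add_comm _ _))
    rw [h1, ← sub_smul]
    congr 1
    ring
  have hpos : 0 < ‖u - u'‖ := norm_pos_iff.2 (sub_ne_zero.2 hne)
  have h1 : |‖u - c‖ - ‖u' - c‖| ≤ ‖u - u'‖ := by
    simpa using abs_norm_sub_norm_le (u - c) (u' - c)
  have h2 : ‖u - u'‖ = |‖u - c‖ - ‖u' - c‖| * ‖v‖ := by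
    conv_lhs => rw [hd]
    rw [norm_smul, Real.norm_eq_abs]
  nlinarith [mul_le_mul_of_nonneg_right h1 (norm_nonneg v), mul_lt_mul_of_pos_left hv1 hpos]

variable {N : Set V} {Φ : V → Fin (m + 1) → ℝ} {Ψ : (Fin (m + 1) → ℝ) → V}
  {c : Fin (m + 1) → ℝ} {δ : ℝ} {v : Fin (m + 1) → ℝ}

lemma pushMap_mem (hch : IsPLChart N (stdSimplex ℝ (Fin (m + 1))) Φ Ψ) (hδ : ∀ i, δ ≤ c i)
    (hv0 : ∑ i, v i = 0) (hv1 : ‖v‖ < 1) {y : V} (hy : y ∈ N ∧ ‖Φ y - c‖ < δ) :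
    pushMap N Φ Ψ c δ v y ∈ N ∧
      Φ (pushMap N Φ Ψ c δ v y) = Φ y + (δ - ‖Φ y - c‖) • v := by
  have hm := (displacement_mem hδ hv0 hv1 (hch.mapsTo hy.1) hy.2).1
  rw [pushMap, if_pos hy]
  exact ⟨hch.mapsTo_symm hm, hch.right_inv hm⟩

lemma pushMap_injective (hch : IsPLChart N (stdSimplex ℝ (Fin (m + 1))) Φ Ψ) (hδ : ∀ i, δ ≤ c i)
    (hv0 : ∑ i, v i = 0) (hv1 : ‖v‖ < 1) : Function.Injective (pushMap N Φ Ψ c δ v) := by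
  have hstay : ∀ y, y ∈ N ∧ ‖Φ y - c‖ < δ →
      pushMap N Φ Ψ c δ v y ∈ N ∧ ‖Φ (pushMap N Φ Ψ c δ v y) - c‖ < δ := by
    intro y hy
    obtain ⟨h1, h2⟩ := pushMap_mem hch hδ hv0 hv1 hy
    exact ⟨h1, h2 ▸ (displacement_mem hδ hv0 hv1 (hch.mapsTo hy.1) hy.2).2.1⟩
  have hid : ∀ y, ¬(y ∈ N ∧ ‖Φ y - c‖ < δ) → pushMap N Φ Ψ c δ v y = y := fun y hy => by
    rw [pushMap, if_neg hy]
  intro y y' h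
  by_cases hy : y ∈ N ∧ ‖Φ y - c‖ < δ <;> by_cases hy' : y' ∈ N ∧ ‖Φ y' - c‖ < δ
  · have := congrArg Φ h
    rw [(pushMap_mem hch hδ hv0 hv1 hy).2, (pushMap_mem hch hδ hv0 hv1 hy').2] at this
    exact hch.left_inv.injOn hy.1 hy'.1 (displacement_injective hv1 this)
  · rw [hid y' hy'] at h
    exact (hy' (h ▸ hstay y hy)).elim
  · rw [hid y hy] at h
    exact (hy (h ▸ hstay y' hy')).elim
  · rwa [hid y hy, hid y' hy'] at h

lemma pushMap_eq_on_chart (hch : IsPLChart N (stdSimplex ℝ (Fin (m + 1))) Φ Ψ) {y : V}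
    (hy : y ∈ N) :
    pushMap N Φ Ψ c δ v y = Ψ (Φ y + max 0 (δ - ‖Φ y - c‖) • v) := by
  by_cases h : ‖Φ y - c‖ < δ
  · rw [pushMap, if_pos ⟨hy, h⟩, max_eq_right (sub_pos.2 h).le]
  · rw [pushMap, if_neg (fun h' => h h'.2), max_eq_left (by linarith), zero_smul, add_zero,
      hch.left_inv hy]

lemma displacement_max_mem (hδ : ∀ i, δ ≤ c i)
    (hv0 : ∑ i, v i = 0) (hv1 : ‖v‖ < 1) {u : Fin (m + 1) → ℝ}
    (hu : u ∈ stdSimplex ℝ (Fin (m + 1))) :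
    u + max 0 (δ - ‖u - c‖) • v ∈ stdSimplex ℝ (Fin (m + 1)) := by
  by_cases h : ‖u - c‖ < δ
  · rw [max_eq_right (sub_pos.2 h).le]
    exact (displacement_mem hδ hv0 hv1 hu h).1
  · rwa [max_eq_left (by linarith), zero_smul, add_zero]

lemma pushMap_continuousOn (hch : IsPLChart N (stdSimplex ℝ (Fin (m + 1))) Φ Ψ)
    (hδ : ∀ i, δ ≤ c i) (hv0 : ∑ i, v i = 0) (hv1 : ‖v‖ < 1) {X : Set V}
    (hnhd : ∀ w ∈ stdSimplex ℝ (Fin (m + 1)), ‖w - c‖ ≤ δ → N ∈ 𝓝[X] (Ψ w)) :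
    ContinuousOn (pushMap N Φ Ψ c δ v) X := by
  have hN : ContinuousOn (pushMap N Φ Ψ c δ v) N := by
    have h1 : ContinuousOn (fun y => Φ y + max 0 (δ - ‖Φ y - c‖) • v) N :=
      hch.continuousOn.add ((continuousOn_const.sup (continuousOn_const.sub
        (hch.continuousOn.sub continuousOn_const).norm)).smul continuousOn_const)
    refine (hch.continuousOn_symm.comp h1 fun y hy =>
      displacement_max_mem hδ hv0 hv1 (hch.mapsTo hy)).congr fun y hy => ?_
    exact pushMap_eq_on_chart hch hy
  have hclosed : IsClosed (N ∩ (fun y => ‖Φ y - c‖) ⁻¹' Iic δ) :=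
    (hch.continuousOn.sub continuousOn_const).norm.preimage_isClosed_of_isClosed
      hch.isCompact.isClosed isClosed_Iic
  intro y hyX
  by_cases hy : y ∈ N ∩ (fun y => ‖Φ y - c‖) ⁻¹' Iic δ
  · have hmem : N ∈ 𝓝[X] y := by
      have := hnhd (Φ y) (hch.mapsTo hy.1) hy.2
      rwa [hch.left_inv hy.1] at this
    exact (hN y hy.1).mono_of_mem_nhdsWithin hmem
  · have hev : pushMap N Φ Ψ c δ v =ᶠ[𝓝[X] y] id := by
      filter_upwards [mem_nhdsWithin_of_mem_nhds (hclosed.isOpen_compl.mem_nhds hy)] with z hz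
      rw [pushMap, if_neg fun h => hz ⟨h.1, h.2.le⟩, id]
    refine continuousWithinAt_id.congr_of_eventuallyEq hev ?_
    rw [pushMap, if_neg fun h => hy ⟨h.1, h.2.le⟩, id]

lemma signAffineOn_displacement (c v : Fin (m + 1) → ℝ) (δ : ℝ) :
    SignAffineOn univ (fun u : Fin (m + 1) → ℝ => u + (δ - ‖u - c‖) • v) := by
  obtain ⟨L, hL⟩ := signAffineOn_norm_sub c univ
  refine ⟨L, fun x hx => ?_⟩
  obtain ⟨g, hg⟩ := hL x hx
  refine ⟨AffineMap.id ℝ _ + (LinearMap.toSpanSingleton ℝ (Fin (m + 1) → ℝ) v).toAffineMap.comp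
    (AffineMap.const ℝ _ δ - g), fun y hy hxy => ?_⟩
  have := hg y hy hxy
  simp only at this
  simp [this, sub_smul]

lemma signAffineOn_pushMap (hch : IsPLChart N (stdSimplex ℝ (Fin (m + 1))) Φ Ψ)
    (hδ : ∀ i, δ ≤ c i) (hv0 : ∑ i, v i = 0) (hv1 : ‖v‖ < 1) (U : Submodule ℝ V)
    (hU : FiniteDimensional ℝ U) : SignAffineOn (U : Set V) (pushMap N Φ Ψ c δ v) := by
  have hdet : SignDetermined (U : Set V) (N ∩ Φ ⁻¹' ((fun u => ‖u - c‖) ⁻¹' Iio δ)) :=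
    (hch.signDetermined U hU).inter (((signDetermined_Iio univ δ).preimage
      (signAffineOn_norm_sub c univ) (mapsTo_univ _ _)).preimage
        (hch.signAffineOn_inter U hU) (mapsTo_univ _ _))
  refine signAffineOn_of_inter_compl hdet ?_ ?_
  · have h1 : SignAffineOn (U ∩ (N ∩ Φ ⁻¹' ((fun u => ‖u - c‖) ⁻¹' Iio δ))) Φ :=
      (hch.signAffineOn_inter U hU).mono fun y hy => ⟨hy.1, hy.2.1⟩
    have h2 := (signAffineOn_displacement c v δ).comp h1 (mapsTo_univ _ _)
    refine (hch.signAffineOn_symm.comp h2 fun y hy => ?_).congr fun y hy => ?_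
    · exact (displacement_mem hδ hv0 hv1 (hch.mapsTo hy.2.1) hy.2.2).1
    · rw [pushMap, if_pos ⟨hy.2.1, hy.2.2⟩]
  · refine signAffineOn_of_affine (AffineMap.id ℝ V) fun y hy => ?_
    rw [pushMap, if_neg fun h => hy.2 ⟨h.1, h.2⟩, AffineMap.id_apply]

end Push

section Approximation

variable {E H : Type*} [NormedAddCommGroup E] [NormedSpace ℝ E]
  [NormedAddCommGroup H] [InnerProductSpace ℝ H]

/-- `F` restricts to a piecewise linear embedding of `B` into `Y`. -/
structure IsPLEmbeddingOn (B : Set E) (Y : Set H) (F : E → H) : Prop where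
  affine : SimplexwiseAffineOn B F
  injOn : InjOn F B
  mapsTo : MapsTo F B Y

/-- Embeddings into `Y` can be moved slightly so as to miss `K` wherever they lie in `O`, and
wherever they missed it before. -/
def CanPushOff (B : Set E) (Y K O : Set H) : Prop :=
  ∀ F : E → H, IsPLEmbeddingOn B Y F → ∀ η > 0, ∃ F' : E → H, IsPLEmbeddingOn B Y F' ∧
    (∀ b ∈ B, dist (F b) (F' b) < η) ∧ ∀ b ∈ B, F b ∈ O ∨ F b ∉ K → F' b ∉ K

lemma manifoldInterior_subset_space (M : Geometry.SimplicialComplex ℝ H) (m : ℕ) :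
    manifoldInterior M m ⊆ M.space := by
  rintro x ⟨N, hN, -, hx, -⟩
  exact hN hx

/-- Every interior point has a neighbourhood in which embeddings can be pushed off a thin set. -/
lemma exists_nhd_canPushOff {m d d' : ℕ} (hd : d + d' < m) (M : Geometry.SimplicialComplex ℝ H)
    {K : Set H} (hK : IsThin d' K) {B : Set E} (hB : IsThin d B) {x : H}
    (hx : x ∈ manifoldInterior M m) :
    ∃ O : Set H, IsOpen O ∧ x ∈ O ∧ CanPushOff B (manifoldInterior M m) K O := by
  classical
  obtain ⟨N, hNM, hNx, hxN, φ, hφ, hbij, hpos⟩ := hx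
  obtain ⟨Φ, Ψ, hch, hΦφ⟩ := exists_isPLChart hφ hbij
  set c := Φ x with hc
  have hcΔ : c ∈ stdSimplex ℝ (Fin (m + 1)) := hch.mapsTo hxN
  have hcpos : ∀ i, 0 < c i := fun i => by
    rw [hc, hΦφ ⟨x, hxN⟩]
    exact hpos i
  obtain ⟨G, hGo, hxG, hGN⟩ := mem_nhdsWithin.1 hNx
  have hΨc : Ψ c = x := hch.left_inv hxN
  obtain ⟨δ₁, hδ₁, hball⟩ := Metric.mem_nhdsWithin_iff.1
    ((hch.continuousOn_symm c hcΔ).preimage_mem_nhdsWithin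
      (hGo.mem_nhds (hΨc.symm ▸ hxG)))
  obtain ⟨i₀, -, hi₀⟩ := Finset.exists_min_image Finset.univ c Finset.univ_nonempty
  set δ := min (δ₁ / 2) (c i₀) with hδdef
  have hδ0 : 0 < δ := lt_min (by linarith) (hcpos i₀)
  have hδ : ∀ i, δ ≤ c i := fun i => (min_le_right _ _).trans (hi₀ i (Finset.mem_univ i))
  have hnhd : ∀ w ∈ stdSimplex ℝ (Fin (m + 1)), ‖w - c‖ ≤ δ → N ∈ 𝓝[M.space] (Ψ w) := by
    intro w hw hwc
    have hwG : Ψ w ∈ G := by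
      refine hball ⟨?_, hw⟩
      rw [Metric.mem_ball, dist_eq_norm]
      exact hwc.trans_lt ((min_le_left _ _).trans_lt (by linarith))
    exact mem_nhdsWithin.2 ⟨G, hGo, hwG, hGN⟩
  -- the points that the pushing maps move
  have hOmem : N ∩ Φ ⁻¹' Metric.ball c δ ∈ 𝓝[M.space] x := by
    have h1 : Φ ⁻¹' Metric.ball c δ ∈ 𝓝[N] x :=
      (hch.continuousOn x hxN).preimage_mem_nhdsWithin (Metric.ball_mem_nhds _ hδ0)
    have h2 : N ∩ Φ ⁻¹' Metric.ball c δ ∈ 𝓝[N] x := Filter.inter_mem self_mem_nhdsWithin h1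
    exact nhdsWithin_le_of_mem hNx h2
  obtain ⟨O, hOo, hxO, hON⟩ := mem_nhdsWithin.1 hOmem
  refine ⟨O, hOo, hxO, fun F hF η hη => ?_⟩
  have hΔc : IsCompact (stdSimplex ℝ (Fin (m + 1))) := isCompact_stdSimplex ℝ _
  obtain ⟨ρ, hρ, huc⟩ := Metric.uniformContinuousOn_iff.1
    (hΔc.uniformContinuousOn_of_continuous hch.continuousOn_symm) η hη
  obtain ⟨G₁, hG₁, hFG₁⟩ := hF.affine.exists_finite_family
  have hthinF : IsThin d (Φ '' (F '' B ∩ N)) :=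
    ((hB.image hG₁.countable hFG₁).mono inter_subset_left).image_signAffineOn
      (hch.signAffineOn.mono inter_subset_right)
  have hthinK : IsThin d' (Φ '' (K ∩ N)) :=
    (hK.mono inter_subset_left).image_signAffineOn (hch.signAffineOn.mono inter_subset_right)
  obtain ⟨v, hv0, hvr, hoff⟩ := exists_small_displacement hd hthinF hthinK c δ
    (r := min 1 (ρ / δ)) (lt_min one_pos (div_pos hρ hδ0))
  have hv1 : ‖v‖ < 1 := hvr.trans_le (min_le_left _ _)
  have hvρ : ‖v‖ * δ < ρ := (lt_div_iff₀ hδ0).1 (hvr.trans_le (min_le_right _ _))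
  obtain ⟨U, hU, hFU⟩ := hF.affine.exists_finiteDimensional_image
  have hFM : F '' B ⊆ M.space := by
    rintro _ ⟨b, hb, rfl⟩
    exact manifoldInterior_subset_space M m (hF.mapsTo hb)
  have hid : ∀ y, ¬(y ∈ N ∧ ‖Φ y - c‖ < δ) → pushMap N Φ Ψ c δ v y = y := fun y hy => by
    rw [pushMap, if_neg hy]
  refine ⟨fun b => pushMap N Φ Ψ c δ v (F b), ⟨?_, ?_, ?_⟩, ?_, ?_⟩
  · exact hF.affine.comp ((signAffineOn_pushMap hch hδ hv0 hv1 U hU).mono hFU)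
      ((pushMap_continuousOn hch hδ hv0 hv1 hnhd).mono hFM)
  · exact (pushMap_injective hch hδ hv0 hv1).injOn.comp hF.injOn (mapsTo_univ _ _)
  · intro b hb
    by_cases hy : F b ∈ N ∧ ‖Φ (F b) - c‖ < δ
    · obtain ⟨h1, h2⟩ := pushMap_mem hch hδ hv0 hv1 hy
      obtain ⟨h3, h4, h5⟩ := displacement_mem hδ hv0 hv1 (hch.mapsTo hy.1) hy.2
      refine ⟨N, hNM, ?_, h1, φ, hφ, hbij, fun i => ?_⟩
      · have := hnhd _ h3 h4.le
        rwa [← h2, hch.left_inv h1] at this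
      · rw [← hΦφ, h2]
        exact h5 i
    · simp only [hid _ hy]
      exact hF.mapsTo hb
  · intro b hb
    by_cases hy : F b ∈ N ∧ ‖Φ (F b) - c‖ < δ
    · have h3 := (displacement_mem hδ hv0 hv1 (hch.mapsTo hy.1) hy.2).1
      have := huc (Φ (F b)) (hch.mapsTo hy.1) _ h3 ?_
      · rw [hch.left_inv hy.1] at this
        simpa only [pushMap, if_pos hy] using this
      · rw [dist_eq_norm, sub_add_cancel_left, norm_neg, norm_smul,
          Real.norm_of_nonneg (sub_pos.2 hy.2).le]
        nlinarith [norm_nonneg v, norm_nonneg (Φ (F b) - c),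
          mul_nonneg (norm_nonneg (Φ (F b) - c)) (norm_nonneg v)]
    · simpa only [hid _ hy, dist_self] using hη
  · intro b hb hO hmemK
    by_cases hy : F b ∈ N ∧ ‖Φ (F b) - c‖ < δ
    · obtain ⟨h1, h2⟩ := pushMap_mem hch hδ hv0 hv1 hy
      refine hoff (Φ (F b)) ⟨F b, ⟨mem_image_of_mem F hb, hy.1⟩, rfl⟩ hy.2 ?_
      rw [← h2]
      exact ⟨_, ⟨hmemK, h1⟩, rfl⟩
    · simp only [hid _ hy] at hmemK
      rcases hO with hO | hO
      · have := hON ⟨hO, hFM (mem_image_of_mem F hb)⟩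
        exact hy ⟨this.1, by simpa [dist_eq_norm] using this.2⟩
      · exact hO hmemK

/-- Pushing off `K` in finitely many open sets one after the other. -/
lemma exists_push_off_finset {B : Set E} {Y K : Set H} {O : H → Set H} (t : Finset H)
    (ht : ∀ x ∈ t, CanPushOff B Y K (O x)) {F : E → H} (hF : IsPLEmbeddingOn B Y F) {η : ℝ}
    (hη : 0 < η) :
    ∃ F' : E → H, IsPLEmbeddingOn B Y F' ∧ (∀ b ∈ B, dist (F b) (F' b) < η) ∧
      ∀ b ∈ B, (F b ∉ K ∨ ∃ x ∈ t, Metric.ball (F b) η ⊆ O x) → F' b ∉ K := by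
  classical
  induction t using Finset.induction_on generalizing F η with
  | empty => exact ⟨F, hF, fun b _ => by simpa using hη, fun b _ h => by simpa using h⟩
  | insert x t _ ih =>
    obtain ⟨F₁, hF₁, hd₁, hK₁⟩ := ht x (Finset.mem_insert_self x t) F hF (η / 2) (half_pos hη)
    obtain ⟨F₂, hF₂, hd₂, hK₂⟩ := ih (fun y hy => ht y (Finset.mem_insert_of_mem hy)) hF₁
      (half_pos hη)
    refine ⟨F₂, hF₂, fun b hb => ?_, fun b hb h => hK₂ b hb ?_⟩
    · linarith [dist_triangle (F b) (F₁ b) (F₂ b), hd₁ b hb, hd₂ b hb]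
    · rcases h with h | ⟨y, hy, hby⟩
      · exact Or.inl (hK₁ b hb (Or.inr h))
      · rcases Finset.mem_insert.1 hy with rfl | hy
        · exact Or.inl (hK₁ b hb (Or.inl (hby (Metric.mem_ball_self hη))))
        · refine Or.inr ⟨y, hy, Subset.trans (Metric.ball_subset_ball' ?_) hby⟩
          linarith [hd₁ b hb, dist_comm (F b) (F₁ b)]

lemma IsPLBall.isThin {q : ℕ} {B : Set E} (hB : IsPLBall q B) : IsThin q B := by
  obtain ⟨ψ, hψ, hbij⟩ := hB
  obtain ⟨Φ, Ψ, hch, -⟩ := exists_isPLChart hψ hbij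
  refine ((isThin_stdSimplex q).image_signAffineOn hch.signAffineOn_symm).mono fun b hb => ?_
  exact ⟨Φ b, hch.mapsTo hb, hch.left_inv hb⟩

end Approximation

end NobelingPL

/-- A PL-embedding of a `q`-ball, `q ≤ n`, into the interior of an `m`-dimensional triangulated
manifold with simplexes linear in a Hilbert space `H`, where `m ≥ 2n+1`, can be arbitrarily closely
approximated by PL-embeddings missing a countable union of planes of dimension `≤ k = m-n-1`. -/
theorem approximate_ball_embedding_off_planes
    {H : Type*} [NormedAddCommGroup H] [InnerProductSpace ℝ H] [CompleteSpace H]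
    {E : Type*} [NormedAddCommGroup E] [NormedSpace ℝ E]
    (n m k : ℕ) (hm : 2 * n + 1 ≤ m) (hk : k = m - n - 1)
    (M : Geometry.SimplicialComplex ℝ H) (hM : NobelingPL.IsCombinatorialManifold M m)
    (planes : Set (AffineSubspace ℝ H)) (hcount : planes.Countable)
    (hdim : ∀ P ∈ planes, FiniteDimensional ℝ P.direction ∧ Module.finrank ℝ P.direction ≤ k)
    (K X : Set H) (hK : K = ⋃ P ∈ planes, (P : Set H)) (hX : X = M.space \ K)
    (q : ℕ) (hq : q ≤ n) (B : Set E) (hB : NobelingPL.IsPLBall q B)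
    (f : B → NobelingPL.manifoldInterior M m) (hf : NobelingPL.IsPLEmbedding f)
    (𝒰 : Set (Set (NobelingPL.manifoldInterior M m))) (h𝒰 : NobelingPL.IsOpenCover 𝒰) :
    ∃ f' : B → NobelingPL.manifoldInterior M m,
      NobelingPL.IsPLEmbedding f' ∧ (∀ x : B, (f' x : H) ∈ X) ∧ NobelingPL.UClose 𝒰 f f' := by
  classical
  have hthinK : NobelingPL.IsThin k K := ⟨planes, hcount, hdim, hK.subset⟩
  have hqk : q + k < m := by omega
  let F : E → H := fun x => if hx : x ∈ B then f ⟨x, hx⟩ else 0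
  have hFf : ∀ x : B, F x = f x := fun x => by simp only [F, dif_pos x.2]
  have hF : NobelingPL.IsPLEmbeddingOn B (NobelingPL.manifoldInterior M m) F := by
    refine ⟨?_, fun x hx y hy hxy => ?_, fun x hx => ?_⟩
    · obtain ⟨T, hT, hTB, hg⟩ := hf.1
      refine ⟨T, hT, hTB, fun s hs => ?_⟩
      obtain ⟨g, hg⟩ := hg s hs
      refine ⟨g, fun x hx => ?_⟩
      have hxB : x ∈ B := hTB ▸ T.convexHull_subset_space hs hx
      rw [hFf ⟨x, hxB⟩]
      exact hg ⟨x, hxB⟩ hx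
    · rw [hFf ⟨x, hx⟩, hFf ⟨y, hy⟩] at hxy
      exact congrArg Subtype.val (hf.2 (Subtype.ext hxy))
    · rw [hFf ⟨x, hx⟩]
      exact (f ⟨x, hx⟩).2
  have hcompact : IsCompact (F '' B) := hF.affine.isCompact.image_of_continuousOn
    hF.affine.continuousOn
  have hO : ∀ x ∈ NobelingPL.manifoldInterior M m, ∃ O : Set H, IsOpen O ∧ x ∈ O ∧
      NobelingPL.CanPushOff B (NobelingPL.manifoldInterior M m) K O := fun x hx =>
    NobelingPL.exists_nhd_canPushOff hqk M hthinK hB.isThin hx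
  choose! O hOo hxO hpush using hO
  have hsubY : F '' B ⊆ NobelingPL.manifoldInterior M m := hF.mapsTo.image_subset
  obtain ⟨t, htB, htcover⟩ := hcompact.elim_nhds_subcover O fun x hx =>
    (hOo x (hsubY hx)).mem_nhds (hxO x (hsubY hx))
  obtain ⟨ε₁, hε₁, hleb₁⟩ := lebesgue_number_lemma_of_metric (c := fun x : t => O x) hcompact
    (fun x => hOo x (hsubY (htB x x.2)))
    (htcover.trans (iUnion₂_subset fun x hx => subset_iUnion (fun x : t => O x) ⟨x, hx⟩))
  have hrange : IsCompact (range f) := by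
    rw [Subtype.isCompact_iff]
    convert hcompact using 1
    ext y
    constructor
    · rintro ⟨_, ⟨b, rfl⟩, rfl⟩
      exact ⟨b, b.2, hFf b⟩
    · rintro ⟨b, hb, rfl⟩
      exact ⟨f ⟨b, hb⟩, ⟨⟨b, hb⟩, rfl⟩, (hFf ⟨b, hb⟩).symm⟩
  obtain ⟨ε₂, hε₂, hleb₂⟩ := lebesgue_number_lemma_of_metric_sUnion hrange h𝒰.1
    (by rw [h𝒰.2]; exact subset_univ _)
  obtain ⟨F', hF', hdist, hoff⟩ := NobelingPL.exists_push_off_finset t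
    (fun x hx => hpush x (hsubY (htB x hx))) hF (lt_min hε₁ hε₂)
  have hFK : ∀ b ∈ B, F' b ∉ K := by
    intro b hb
    obtain ⟨x, hx⟩ := hleb₁ (F b) (mem_image_of_mem F hb)
    exact hoff b hb (Or.inr ⟨x, x.2, (Metric.ball_subset_ball (min_le_left _ _)).trans hx⟩)
  refine ⟨fun b => ⟨F' b, hF'.mapsTo b.2⟩, ⟨?_, fun x y hxy => ?_⟩, fun b => ?_, fun b => ?_⟩
  · obtain ⟨T, hT, hTB, hg⟩ := hF'.affine
    refine ⟨T, hT, hTB, fun s hs => ?_⟩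
    obtain ⟨g, hg⟩ := hg s hs
    exact ⟨g, fun x hx => hg x hx⟩
  · exact Subtype.ext (hF'.injOn x.2 y.2 (congrArg Subtype.val hxy))
  · rw [hX]
    exact ⟨NobelingPL.manifoldInterior_subset_space M m (hF'.mapsTo b.2), hFK b b.2⟩
  · obtain ⟨U, hU, hbU⟩ := hleb₂ (f b) (mem_range_self b)
    refine ⟨U, hU, hbU (Metric.mem_ball_self hε₂), hbU ?_⟩
    rw [Metric.mem_ball, Subtype.dist_eq, dist_comm, ← hFf b]
    exact (hdist b b.2).trans_le (min_le_right _ _)
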